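/- arXiv:2604.02882 — 2 statements merged into one kernel-verified Lean document; each statement's English description precedes it below -/
import Mathlib

section
/- Let $d\ge 1$ and let $f:\mathbb R^d\to\mathbb R$ be four times continuously differentiable, with a unique global minimizer $x^\ast\in\mathbb R^d$ whose value is not approached at infinity, i.e. $\liminf_{\|x\|\to\infty} f(x)>f(x^\ast)$. Assume that the Hessian $H_f(x^\ast)$ is positive definite and that $\int_{\mathbb R^d} e^{-f(x)}\,dx<\infty$. For $\alpha>0$ set $$Z_\alpha:=\int_{\mathbb R^d} e^{-\alpha f(x)}\,dx,\qquad m_\alpha:=\sqrt{\det H_f(x^\ast)}\,\Bigl(\frac{\alpha}{2\pi}\Bigr)^{d/2}.$$ Then there exist constants $C>0$ and $\tilde\alpha>1$, depending only on $f$, such that for every $\alpha\ge\tilde\alpha$, $$\frac{Z_{2\alpha}}{Z_\alpha^2}\le 2^{-d/2}\,m_\alpha\Bigl(1+\frac{8C}{\alpha}\Bigr).$$ -/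
open MeasureTheory Real

noncomputable section

/-- `ℝ^d` as a Euclidean space. -/
abbrev E (d : ℕ) := EuclideanSpace ℝ (Fin d)

/-- The `i`-th standard basis vector of `ℝ^d`. -/
def bvec (d : ℕ) (i : Fin d) : E d := EuclideanSpace.single i 1

/-- The normalizing constant `Z_α := ∫ exp (-α f)`. -/
def Zc {d : ℕ} (f : E d → ℝ) (α : ℝ) : ℝ := ∫ x, Real.exp (-α * f x)

/-- The Hessian matrix of `f` at `x`, via the second iterated derivative. -/
def hess {d : ℕ} (f : E d → ℝ) (x : E d) : Matrix (Fin d) (Fin d) ℝ :=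
  Matrix.of fun i j => iteratedFDeriv ℝ 2 f x ![bvec d i, bvec d j]

/-- `m_α := √(det H_f(x⋆)) · (α/(2π))^{d/2}`. -/
def mconst {d : ℕ} (f : E d → ℝ) (xs : E d) (α : ℝ) : ℝ :=
  Real.sqrt (hess f xs).det * (α / (2 * π)) ^ ((d : ℝ) / 2)

end

theorem exists_taylor_bounds {d : ℕ} {f : E d → ℝ} {xs : E d} (hf : ContDiff ℝ 4 f)
    (hcrit : fderiv ℝ f xs = 0) :
    ∃ K : ℝ, 0 < K ∧ ∀ y : E d, ‖y‖ ≤ 1 →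
      |f (xs + y) - f xs - iteratedFDeriv ℝ 2 f xs (fun _ => y) / 2| ≤ K * ‖y‖ ^ 3 ∧
      |f (xs + y) + f (xs - y) - 2 * f xs - iteratedFDeriv ℝ 2 f xs (fun _ => y)|
        ≤ K * ‖y‖ ^ 4 := by
  have hcont : Continuous (fun x => ‖iteratedFDeriv ℝ 4 f x‖) :=
    (hf.continuous_iteratedFDeriv le_rfl).norm
  obtain ⟨M, hM⟩ := (isCompact_closedBall xs 1).bddAbove_image hcont.continuousOn
  have hM' : ∀ z : E d, ‖z‖ ≤ 1 → ‖iteratedFDeriv ℝ 4 f (xs + z)‖ ≤ M := fun z hz =>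
    hM ⟨xs + z, by simpa using hz, rfl⟩
  have hM0 : 0 ≤ M := (norm_nonneg _).trans (hM' 0 (by simp))
  have key : ∀ y : E d, ‖y‖ ≤ 1 →
      |f (xs + y) - (f xs + iteratedFDeriv ℝ 2 f xs (fun _ => y) / 2 +
        iteratedFDeriv ℝ 3 f xs (fun _ => y) / 6)| ≤ M * ‖y‖ ^ 4 := by
    intro y hy
    have h := map_add_eq_sum_add_integral_iteratedFDeriv (f := f) (x := xs) (y := y) (n := 3)
      (fun t _ => by exact_mod_cast hf.contDiffAt)
    have hI : ‖∫ t in (0 : ℝ)..1, (1 - t) ^ 3 • iteratedFDeriv ℝ (3 + 1) f (xs + t • y)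
        (fun _ => y)‖ ≤ (M * ‖y‖ ^ 4) * |1 - 0| := by
      refine intervalIntegral.norm_integral_le_of_norm_le_const fun t ht => ?_
      rw [Set.uIoc_of_le zero_le_one] at ht
      rw [norm_smul]
      have h1 : ‖(1 - t) ^ 3‖ ≤ 1 := by
        rw [norm_pow, Real.norm_eq_abs, abs_of_nonneg (by linarith [ht.2])]
        exact pow_le_one₀ (by linarith [ht.2]) (by linarith [ht.1])
      have h2 : ‖iteratedFDeriv ℝ (3 + 1) f (xs + t • y) (fun _ => y)‖ ≤ M * ‖y‖ ^ 4 := by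
        refine (ContinuousMultilinearMap.le_opNorm _ _).trans ?_
        have : ‖t • y‖ ≤ 1 := by
          rw [norm_smul, Real.norm_eq_abs, abs_of_pos ht.1]
          exact mul_le_one₀ ht.2 (norm_nonneg _) hy
        simpa using mul_le_mul_of_nonneg_right (hM' _ this) (by positivity)
      calc _ ≤ 1 * (M * ‖y‖ ^ 4) := by gcongr
        _ = _ := one_mul _
    simp only [Finset.sum_range_succ, Finset.range_zero, Finset.sum_empty, Nat.factorial,
      iteratedFDeriv_zero_apply, iteratedFDeriv_one_apply, hcrit] at h
    rw [h]
    rw [Real.norm_eq_abs] at hI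
    simp only [smul_eq_mul] at hI ⊢
    norm_num at hI ⊢
    rw [abs_le] at hI ⊢
    constructor <;> nlinarith [hI.1, hI.2, mul_nonneg hM0 (pow_nonneg (norm_nonneg y) 4)]
  have hcub : ∀ y : E d, |iteratedFDeriv ℝ 3 f xs (fun _ => y)| ≤
      ‖iteratedFDeriv ℝ 3 f xs‖ * ‖y‖ ^ 3 := fun y => by
    simpa using (iteratedFDeriv ℝ 3 f xs).le_opNorm (fun _ => y)
  have hneg : ∀ (k : ℕ) (y : E d), iteratedFDeriv ℝ k f xs (fun _ => -y) =
      (-1) ^ k * iteratedFDeriv ℝ k f xs (fun _ => y) := fun k y => by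
    simpa using (iteratedFDeriv ℝ k f xs).map_smul_univ (fun _ => (-1 : ℝ)) (fun _ => y)
  refine ⟨2 * M + ‖iteratedFDeriv ℝ 3 f xs‖ + 1, by positivity, fun y hy => ?_⟩
  set N := ‖iteratedFDeriv ℝ 3 f xs‖
  have hN : 0 ≤ N := norm_nonneg _
  have h1 := key y hy
  have h2 := key (-y) (by simpa using hy)
  have h3 := hcub y
  rw [hneg, hneg, ← sub_eq_add_neg, norm_neg] at h2
  have h34 : ‖y‖ ^ 4 ≤ ‖y‖ ^ 3 := pow_le_pow_of_le_one (norm_nonneg _) hy (by norm_num)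
  have p3 : 0 ≤ ‖y‖ ^ 3 := by positivity
  have p4 : 0 ≤ ‖y‖ ^ 4 := by positivity
  have m3 := mul_le_mul_of_nonneg_left h34 hM0
  have m4 := mul_nonneg hM0 p3
  have m5 := mul_nonneg hN p3
  have m6 := mul_nonneg hN p4
  rw [abs_le] at h1 h2 h3
  constructor <;> rw [abs_le] <;> constructor <;> linarith [h1.1, h1.2, h2.1, h2.2, h3.1, h3.2]

theorem exists_gap_of_not_mem_ball {d : ℕ} {f : E d → ℝ} {xs : E d} (hf : Continuous f)
    (hmin : ∀ x, x ≠ xs → f xs < f x)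
    (hinf : ∃ R : ℝ, ∃ η : ℝ, 0 < η ∧ ∀ x : E d, R ≤ ‖x‖ → f xs + η ≤ f x)
    {δ : ℝ} (hδ : 0 < δ) :
    ∃ η : ℝ, 0 < η ∧ ∀ y : E d, δ ≤ ‖y‖ → η ≤ f (xs + y) - f xs := by
  obtain ⟨R, η, hη, hR⟩ := hinf
  set S : Set (E d) := Metric.closedBall 0 R ∩ {x | δ ≤ ‖x - xs‖}
  have hS : IsCompact S := (isCompact_closedBall 0 R).inter_right
    (isClosed_le continuous_const (by fun_prop))
  have hpos : ∀ x ∈ S, 0 < f x - f xs := fun x hx => by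
    have : x ≠ xs := by
      rintro rfl
      have := hx.2
      simp at this
      linarith
    linarith [hmin x this]
  obtain ⟨η', hη', h'⟩ : ∃ η' : ℝ, 0 < η' ∧ ∀ x ∈ S, η' ≤ f x - f xs := by
    rcases S.eq_empty_or_nonempty with h | h
    · exact ⟨1, one_pos, by simp [h]⟩
    · obtain ⟨x, hx, hxm⟩ := hS.exists_isMinOn h (f := fun x => f x - f xs) (by fun_prop)
      exact ⟨_, hpos x hx, fun z hz => hxm hz⟩
  refine ⟨min η η', lt_min hη hη', fun y hy => ?_⟩
  rcases le_total R ‖xs + y‖ with h | h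
  · exact (min_le_left _ _).trans (by linarith [hR _ h])
  · exact (min_le_right _ _).trans (h' _ ⟨by simpa using h, by simpa using hy⟩)

theorem iteratedFDeriv_two_eq_dotProduct_hess {d : ℕ} (f : E d → ℝ) (x y : E d) :
    iteratedFDeriv ℝ 2 f x (fun _ => y) = y.ofLp ⬝ᵥ (hess f x).mulVec y.ofLp := by
  have hy : y = ∑ i, y i • bvec d i := by
    simpa [bvec] using ((EuclideanSpace.basisFun (Fin d) ℝ).sum_repr y).symm
  rw [iteratedFDeriv_two_apply]
  conv_lhs => rw [hy]
  simp only [map_sum, map_smul, sum_apply, smul_apply,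
    smul_eq_mul, dotProduct, Matrix.mulVec, hess, Matrix.of_apply, iteratedFDeriv_two_apply,
    Finset.mul_sum, Matrix.cons_val_zero, Matrix.cons_val_one]
  rw [Finset.sum_comm]
  refine Finset.sum_congr rfl fun i _ => Finset.sum_congr rfl fun j _ => ?_
  ring

open scoped MatrixOrder in
theorem Matrix.PosDef.exists_linearMap_norm_sq {d : ℕ} {H : Matrix (Fin d) (Fin d) ℝ}
    (hH : H.PosDef) :
    ∃ A : E d →ₗ[ℝ] E d, LinearMap.det A = √H.det ∧
      ∀ y : E d, y.ofLp ⬝ᵥ H.mulVec y.ofLp = ‖A y‖ ^ 2 := by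
  set S := CFC.sqrt H
  have hSS : S * S = H := CFC.sqrt_mul_sqrt_self H hH.posSemidef.nonneg
  have hS : S.IsSymm := by
    simpa using (Matrix.nonneg_iff_posSemidef.1 (CFC.sqrt_nonneg H)).isHermitian
  refine ⟨Matrix.toEuclideanLin S, ?_, fun y => ?_⟩
  · have := hH.posSemidef.det_sqrt
    simp at this
    rw [← this]
    simp [Matrix.toEuclideanLin_eq_toLin_orthonormal, S]
  · rw [EuclideanSpace.real_norm_sq_eq, ← hSS, ← Matrix.mulVec_mulVec, Matrix.dotProduct_mulVec,
      ← Matrix.mulVec_transpose, hS.eq]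
    simp [dotProduct, pow_two, Matrix.toLpLin_apply]

theorem integral_exp_neg_mul_norm_sq_comp_linearMap {d : ℕ} (A : E d →ₗ[ℝ] E d)
    (hA : 0 < LinearMap.det A) {b : ℝ} (hb : 0 < b) :
    ∫ y, rexp (-b * ‖A y‖ ^ 2) = (LinearMap.det A)⁻¹ * (π / b) ^ ((d : ℝ) / 2) := by
  have h := GaussianFourier.integral_rexp_neg_mul_sq_norm (V := E d) hb
  rw [finrank_euclideanSpace_fin] at h
  have hm := Measure.map_linearMap_addHaar_eq_smul_addHaar (volume : Measure (E d)) hA.ne'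
  have hc : Continuous A := A.continuous_of_finiteDimensional
  have h2 : ∫ y, rexp (-b * ‖y‖ ^ 2) ∂(Measure.map A volume) = ∫ y, rexp (-b * ‖A y‖ ^ 2) :=
    integral_map hc.aemeasurable (by fun_prop)
  rw [← h2, hm, integral_smul_measure, h, abs_of_pos (inv_pos.2 hA),
    ENNReal.toReal_ofReal (inv_pos.2 hA).le, smul_eq_mul]

theorem exists_add_sq_add_cube_le_mul_exp {c : ℝ} (hc : 0 < c) :
    ∃ C : ℝ, 0 < C ∧ ∀ x : ℝ, 0 ≤ x → x + x ^ 2 + x ^ 3 ≤ C * rexp (c * x) := by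
  refine ⟨1 / c + 2 / c ^ 2 + 6 / c ^ 3, by positivity, fun x hx => ?_⟩
  have h1 := Real.pow_div_factorial_le_exp (c * x) (by positivity) 1
  have h2 := Real.pow_div_factorial_le_exp (c * x) (by positivity) 2
  have h3 := Real.pow_div_factorial_le_exp (c * x) (by positivity) 3
  norm_num [Nat.factorial] at h1 h2 h3
  have e1 : x = 1 / c * (c * x) := by field_simp
  have e2 : x ^ 2 = 2 / c ^ 2 * ((c * x) ^ 2 / 2) := by field_simp
  have e3 : x ^ 3 = 6 / c ^ 3 * ((c * x) ^ 3 / 6) := by field_simp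
  calc x + x ^ 2 + x ^ 3
      = 1 / c * (c * x) + 2 / c ^ 2 * ((c * x) ^ 2 / 2) + 6 / c ^ 3 * ((c * x) ^ 3 / 6) := by
        rw [← e1, ← e2, ← e3]
    _ ≤ 1 / c * rexp (c * x) + 2 / c ^ 2 * rexp (c * x) + 6 / c ^ 3 * rexp (c * x) := by gcongr
    _ = _ := by ring

theorem abs_exp_sub_one_sub_le (u : ℝ) : |rexp u - 1 - u| ≤ u ^ 2 * rexp |u| := by
  have h := Complex.norm_exp_sub_sum_le_norm_mul_exp (u : ℂ) 2
  simp only [Finset.sum_range_succ, Finset.range_zero, Finset.sum_empty, Complex.norm_real] at h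
  rw [Real.norm_eq_abs, sq_abs] at h
  refine le_trans (le_of_eq ?_) h
  rw [← Real.norm_eq_abs, ← Complex.norm_real]
  congr 1
  push_cast
  simp
  ring

theorem exists_abs_average_exp_sub_le {d : ℕ} {g q : E d → ℝ} {K l : ℝ} (hK : 0 < K) (hl : 0 < l)
    (hq : ∀ y, l * ‖y‖ ^ 2 ≤ q y) (hqe : ∀ y, q (-y) = q y)
    (h3 : ∀ y, ‖y‖ ≤ 1 → |g y - q y / 2| ≤ K * ‖y‖ ^ 3)
    (h4 : ∀ y, ‖y‖ ≤ 1 → |g y + g (-y) - q y| ≤ K * ‖y‖ ^ 4) :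
    ∃ δ : ℝ, 0 < δ ∧ ∃ C : ℝ, 0 < C ∧ ∀ α : ℝ, 0 < α → ∀ y, ‖y‖ ≤ δ →
      |(rexp (-α * g y) + rexp (-α * g (-y))) / 2 - rexp (-(α / 2) * q y)| ≤
        C / α * rexp (-(α * (l / 8)) * ‖y‖ ^ 2) := by
  obtain ⟨C₀, hC₀, hC⟩ := exists_add_sq_add_cube_le_mul_exp (c := l / 8) (by positivity)
  refine ⟨min 1 (l / (4 * K)), by positivity, (K ^ 2 + K) * C₀, by positivity,
    fun α hα y hy => ?_⟩
  have hy1 : ‖y‖ ≤ 1 := hy.trans (min_le_left _ _)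
  have hy2 : K * ‖y‖ ≤ l / 4 := by
    have := hy.trans (min_le_right _ _)
    rw [le_div_iff₀ (by positivity)] at this
    linarith
  set x := α * ‖y‖ ^ 2 with hx
  have hx0 : 0 ≤ x := by positivity
  have hr : ∀ z, ‖z‖ = ‖y‖ → q z = q y →
      |rexp (-α * g z + α / 2 * q y) - 1 - (-α * g z + α / 2 * q y)| ≤
        K ^ 2 * x ^ 3 / α * rexp (l / 4 * x) := by
    intro z hz hzq
    set u := -α * g z + α / 2 * q y with hu
    have hu1 : |u| ≤ α * (K * ‖y‖ ^ 3) := by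
      have := h3 z (hz.trans_le hy1)
      rw [hz, hzq] at this
      have e : u = -(α * (g z - q y / 2)) := by rw [hu]; ring
      rw [e, abs_neg, abs_mul, abs_of_pos hα]
      gcongr
    have hu2 : |u| ≤ l / 4 * x := hu1.trans <| by
      calc α * (K * ‖y‖ ^ 3) = K * ‖y‖ * x := by rw [hx]; ring
        _ ≤ _ := by gcongr
    refine (abs_exp_sub_one_sub_le u).trans ?_
    gcongr
    calc u ^ 2 = |u| ^ 2 := (sq_abs u).symm
      _ ≤ (α * (K * ‖y‖ ^ 3)) ^ 2 := by gcongr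
      _ = K ^ 2 * x ^ 3 / α := by rw [hx]; field_simp
  have hr1 := hr y rfl rfl
  have hr2 := hr (-y) (norm_neg _) (hqe y)
  set u₁ := -α * g y + α / 2 * q y with hu₁
  set u₂ := -α * g (-y) + α / 2 * q y with hu₂
  have hs : |u₁ + u₂| ≤ K * x ^ 2 / α := by
    have e : u₁ + u₂ = -(α * (g y + g (-y) - q y)) := by rw [hu₁, hu₂]; ring
    rw [e, abs_neg, abs_mul, abs_of_pos hα]
    calc α * |g y + g (-y) - q y| ≤ α * (K * ‖y‖ ^ 4) := by gcongr; exact h4 y hy1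
      _ = _ := by rw [hx]; field_simp
  have heq : (rexp (-α * g y) + rexp (-α * g (-y))) / 2 - rexp (-(α / 2) * q y) =
      rexp (-(α / 2) * q y) *
        (((rexp u₁ - 1 - u₁) + (rexp u₂ - 1 - u₂) + (u₁ + u₂)) / 2) := by
    have e1 : rexp (-α * g y) = rexp (-(α / 2) * q y) * rexp u₁ := by
      rw [← Real.exp_add]; congr 1; rw [hu₁]; ring
    have e2 : rexp (-α * g (-y)) = rexp (-(α / 2) * q y) * rexp u₂ := by
      rw [← Real.exp_add]; congr 1; rw [hu₂]; ring
    rw [e1, e2]; ring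
  have hsum : |((rexp u₁ - 1 - u₁) + (rexp u₂ - 1 - u₂) + (u₁ + u₂)) / 2| ≤
      (K ^ 2 + K) * (x + x ^ 2 + x ^ 3) / α * rexp (l / 4 * x) := by
    have hE : 1 ≤ rexp (l / 4 * x) := Real.one_le_exp (by positivity)
    have t1 : K * x ^ 2 / α ≤ K * x ^ 2 / α * rexp (l / 4 * x) :=
      le_mul_of_one_le_right (by positivity) hE
    have t2 : (K ^ 2 * x ^ 3 / α + K * x ^ 2 / α) * rexp (l / 4 * x) ≤
        (K ^ 2 + K) * (x + x ^ 2 + x ^ 3) / α * rexp (l / 4 * x) := by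
      rw [← add_div]
      gcongr
      have : 0 ≤ K ^ 2 * x + K ^ 2 * x ^ 2 + K * x + K * x ^ 3 := by positivity
      linarith
    have t3 : 0 ≤ K * x ^ 2 / α * rexp (l / 4 * x) := by positivity
    rw [abs_div, abs_two, div_le_iff₀ two_pos]
    refine (abs_add_three _ _ _).trans ?_
    linarith
  have hqx : rexp (-(α / 2) * q y) ≤ rexp (-(l / 2 * x)) := by
    gcongr
    rw [hx]
    nlinarith [mul_le_mul_of_nonneg_left (hq y) hα.le]
  rw [heq, abs_mul, abs_of_pos (Real.exp_pos _)]
  calc _ ≤ rexp (-(l / 2 * x)) *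
        ((K ^ 2 + K) * (C₀ * rexp (l / 8 * x)) / α * rexp (l / 4 * x)) := by
        refine mul_le_mul hqx (hsum.trans ?_) (abs_nonneg _) (Real.exp_pos _).le
        gcongr
        exact hC x hx0
    _ = (K ^ 2 + K) * C₀ / α * rexp (-(l / 2 * x) + l / 8 * x + l / 4 * x) := by
        rw [Real.exp_add, Real.exp_add]; ring
    _ = _ := by
        congr 2
        rw [hx]; ring

/-- Outside a ball the Gaussian weight is of the same size as the error term. -/
theorem exists_exp_neg_quadratic_le_of_le_norm {d : ℕ} {q : E d → ℝ} {l δ : ℝ} (hl : 0 < l)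
    (hδ : 0 < δ) (hq : ∀ y, l * ‖y‖ ^ 2 ≤ q y) :
    ∃ C : ℝ, 0 < C ∧ ∀ α : ℝ, 0 < α → ∀ y, δ ≤ ‖y‖ →
      rexp (-(α / 2) * q y) ≤ C / α * rexp (-(α * (l / 8)) * ‖y‖ ^ 2) := by
  obtain ⟨C₀, hC₀, hC⟩ := exists_add_sq_add_cube_le_mul_exp (c := 3 * l / 8) (by positivity)
  refine ⟨C₀ / δ ^ 2, by positivity, fun α hα y hy => ?_⟩
  set x := α * ‖y‖ ^ 2 with hx
  have hx0 : 0 ≤ x := by positivity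
  have h1 : α * δ ^ 2 ≤ C₀ * rexp (3 * l / 8 * x) := by
    have : α * δ ^ 2 ≤ x := by rw [hx]; gcongr
    linarith [hC x hx0, pow_nonneg hx0 2, pow_nonneg hx0 3]
  have h2 : 1 ≤ C₀ / δ ^ 2 / α * rexp (3 * l / 8 * x) := by
    rw [div_div, div_mul_eq_mul_div, le_div_iff₀ (by positivity)]
    linarith
  have hqx : rexp (-(α / 2) * q y) ≤ rexp (-(l / 2 * x)) := by
    gcongr
    rw [hx]
    nlinarith [mul_le_mul_of_nonneg_left (hq y) hα.le]
  calc rexp (-(α / 2) * q y) ≤ 1 * rexp (-(l / 2 * x)) := by rwa [one_mul]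
    _ ≤ C₀ / δ ^ 2 / α * rexp (3 * l / 8 * x) * rexp (-(l / 2 * x)) := by gcongr
    _ = C₀ / δ ^ 2 / α * rexp (-(α * (l / 8)) * ‖y‖ ^ 2) := by
      rw [mul_assoc, ← Real.exp_add]
      congr 2
      rw [hx]; ring

theorem LinearMap.exists_mul_norm_sq_le {d : ℕ} (A : E d →ₗ[ℝ] E d) (hA : LinearMap.det A ≠ 0) :
    ∃ l : ℝ, 0 < l ∧ ∀ y, l * ‖y‖ ^ 2 ≤ ‖A y‖ ^ 2 := by
  have hker : LinearMap.ker A = ⊥ := LinearMap.ker_eq_bot.2 (A.equivOfDetNeZero hA).injective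
  obtain ⟨K, hK, h⟩ := A.exists_antilipschitzWith hker
  refine ⟨((K : ℝ) ^ 2)⁻¹, by positivity, fun y => ?_⟩
  have : ‖y‖ ≤ K * ‖A y‖ := by simpa [dist_eq_norm] using h.le_mul_dist y 0
  rw [inv_mul_le_iff₀ (by positivity), ← mul_pow]
  gcongr

theorem integrable_exp_neg_mul_norm_sq {d : ℕ} {b : ℝ} (hb : 0 < b) :
    Integrable fun y : E d => rexp (-b * ‖y‖ ^ 2) := by
  refine Integrable.of_integral_ne_zero ?_
  rw [GaussianFourier.integral_rexp_neg_mul_sq_norm hb]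
  positivity

theorem integrable_exp_neg_mul_norm_sq_comp_linearMap {d : ℕ} (A : E d →ₗ[ℝ] E d)
    (hA : 0 < LinearMap.det A) {b : ℝ} (hb : 0 < b) :
    Integrable fun y : E d => rexp (-b * ‖A y‖ ^ 2) := by
  refine Integrable.of_integral_ne_zero ?_
  rw [integral_exp_neg_mul_norm_sq_comp_linearMap A hA hb]
  positivity

/-- The even part of the Gibbs weight `exp (-α (f (xs + y) - f xs))`, centred at `xs`. -/
noncomputable def evenGibbs {d : ℕ} (f : E d → ℝ) (xs : E d) (α : ℝ) (y : E d) : ℝ :=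
  (rexp (-α * (f (xs + y) - f xs)) + rexp (-α * (f (xs + -y) - f xs))) / 2

theorem integrable_exp_neg_mul_of_one_le {d : ℕ} {f : E d → ℝ} {xs : E d} (hf : Continuous f)
    (hmin : ∀ x, f xs ≤ f x) (hint : Integrable fun x => rexp (-f x)) {α : ℝ} (hα : 1 ≤ α) :
    Integrable fun x => rexp (-α * f x) := by
  refine (hint.const_mul (rexp (-(α - 1) * f xs))).mono' (by fun_prop) (ae_of_all _ fun x => ?_)
  rw [Real.norm_eq_abs, abs_of_pos (Real.exp_pos _), ← Real.exp_add]
  gcongr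
  nlinarith [mul_le_mul_of_nonneg_left (hmin x) (sub_nonneg.2 hα)]

theorem integrable_evenGibbs {d : ℕ} {f : E d → ℝ} {xs : E d} {α : ℝ}
    (h : Integrable fun x => rexp (-α * f x)) :
    Integrable (evenGibbs f xs α) ∧ ∫ y, evenGibbs f xs α y = rexp (α * f xs) * Zc f α := by
  have e : ∀ x, rexp (-α * (f x - f xs)) = rexp (α * f xs) * rexp (-α * f x) := fun x => by
    rw [← Real.exp_add]; congr 1; ring
  have h0 : Integrable fun x => rexp (-α * (f x - f xs)) := by
    simp_rw [e]; exact h.const_mul _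
  have h1 := h0.comp_add_left xs
  have h2 := h1.comp_neg
  refine ⟨(h1.add h2).div_const 2, ?_⟩
  have i1 : ∫ y, rexp (-α * (f (xs + y) - f xs)) = rexp (α * f xs) * Zc f α := by
    rw [integral_add_left_eq_self (fun x => rexp (-α * (f x - f xs))) xs]
    simp_rw [e]
    rw [integral_const_mul, Zc]
  have i2 : ∫ y, rexp (-α * (f (xs + -y) - f xs)) = rexp (α * f xs) * Zc f α := by
    rw [integral_neg_eq_self (fun y => rexp (-α * (f (xs + y) - f xs))), i1]
  simp only [evenGibbs]
  rw [integral_div, integral_add h1 h2, i1, i2]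
  ring

theorem mconst_pos {d : ℕ} {f : E d → ℝ} {xs : E d} (hpd : (hess f xs).PosDef) {α : ℝ}
    (hα : 0 < α) : 0 < mconst f xs α := by
  have := hpd.det_pos
  unfold mconst
  positivity

theorem exists_abs_mconst_mul_Zc_sub_one_le {d : ℕ} {f : E d → ℝ} {xs : E d}
    (hf : ContDiff ℝ 4 f)
    (hmin : ∀ x, x ≠ xs → f xs < f x)
    (hinf : ∃ R : ℝ, ∃ η : ℝ, 0 < η ∧ ∀ x : E d, R ≤ ‖x‖ → f xs + η ≤ f x)
    (hpd : (hess f xs).PosDef)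
    (hfint : Integrable fun x => rexp (-f x)) :
    ∃ D : ℝ, 0 < D ∧ ∃ α₀ : ℝ, 1 ≤ α₀ ∧ ∀ α : ℝ, α₀ ≤ α →
      |mconst f xs α * (rexp (α * f xs) * Zc f α) - 1| ≤ D / α := by
  have hmin' : ∀ x, f xs ≤ f x := fun x => by
    rcases eq_or_ne x xs with rfl | h
    · exact le_rfl
    · exact (hmin x h).le
  have hcrit : fderiv ℝ f xs = 0 :=
    IsLocalMin.fderiv_eq_zero (Filter.Eventually.of_forall hmin')
  obtain ⟨K, hK, hT⟩ := exists_taylor_bounds hf hcrit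
  obtain ⟨A, hAdet, hAq⟩ := hpd.exists_linearMap_norm_sq
  have hA : 0 < LinearMap.det A := by rw [hAdet]; exact Real.sqrt_pos.2 hpd.det_pos
  have hq : ∀ y, iteratedFDeriv ℝ 2 f xs (fun _ => y) = ‖A y‖ ^ 2 := fun y => by
    rw [iteratedFDeriv_two_eq_dotProduct_hess, hAq]
  simp only [hq] at hT
  obtain ⟨l, hl, hlq⟩ := A.exists_mul_norm_sq_le hA.ne'
  obtain ⟨δ, hδ, C₁, hC₁, hloc⟩ := exists_abs_average_exp_sub_le (g := fun y => f (xs + y) - f xs)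
    (q := fun y => ‖A y‖ ^ 2) hK hl hlq (fun y => by simp) (fun y hy => (hT y hy).1)
    (fun y hy => by
      have := (hT y hy).2
      rw [sub_eq_add_neg xs y] at this
      convert this using 2
      ring)
  obtain ⟨C₂, hC₂, hfar⟩ := exists_exp_neg_quadratic_le_of_le_norm hl hδ hlq
  obtain ⟨η, hη, hgap⟩ := exists_gap_of_not_mem_ball hf.continuous hmin hinf hδ
  set C := max C₁ C₂
  have hC : 0 < C := lt_max_of_lt_left hC₁
  set c := l / 8
  have hc : 0 < c := by positivity
  have hlower : ∀ α : ℝ, 0 < α → ∀ y, rexp (-(α / 2) * ‖A y‖ ^ 2) -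
      C / α * rexp (-(α * c) * ‖y‖ ^ 2) ≤ evenGibbs f xs α y := by
    intro α hα y
    rcases le_total ‖y‖ δ with h | h
    · have h1 := (abs_le.1 (hloc α hα y h)).1
      have h2 : C₁ / α * rexp (-(α * c) * ‖y‖ ^ 2) ≤ C / α * rexp (-(α * c) * ‖y‖ ^ 2) := by
        gcongr; exact le_max_left _ _
      unfold evenGibbs
      linarith
    · have h1 := hfar α hα y h
      have h2 : C₂ / α * rexp (-(α * c) * ‖y‖ ^ 2) ≤ C / α * rexp (-(α * c) * ‖y‖ ^ 2) := by
        gcongr; exact le_max_right _ _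
      have h3 : 0 ≤ evenGibbs f xs α y := by unfold evenGibbs; positivity
      linarith
  have hupper : ∀ α : ℝ, 1 ≤ α → ∀ y, evenGibbs f xs α y ≤ rexp (-(α / 2) * ‖A y‖ ^ 2) +
      C / α * rexp (-(α * c) * ‖y‖ ^ 2) + rexp (-(α - 1) * η) * evenGibbs f xs 1 y := by
    intro α hα y
    have hα0 : 0 < α := by linarith
    rcases le_total ‖y‖ δ with h | h
    · have h1 := (abs_le.1 (hloc α hα0 y h)).2
      have h2 : C₁ / α * rexp (-(α * c) * ‖y‖ ^ 2) ≤ C / α * rexp (-(α * c) * ‖y‖ ^ 2) := by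
        gcongr; exact le_max_left _ _
      have h3 : 0 ≤ rexp (-(α - 1) * η) * evenGibbs f xs 1 y := by unfold evenGibbs; positivity
      unfold evenGibbs at h3 ⊢
      linarith
    · have h1 : 0 ≤ rexp (-(α / 2) * ‖A y‖ ^ 2) + C / α * rexp (-(α * c) * ‖y‖ ^ 2) := by
        positivity
      have h2 : ∀ z, δ ≤ ‖z‖ → rexp (-α * (f (xs + z) - f xs)) ≤
          rexp (-(α - 1) * η) * rexp (-1 * (f (xs + z) - f xs)) := fun z hz => by
        rw [← Real.exp_add]
        gcongr
        nlinarith [mul_le_mul_of_nonneg_left (hgap z hz) (sub_nonneg.2 hα)]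
      have h3 := h2 y h
      have h4 := h2 (-y) (by rwa [norm_neg])
      unfold evenGibbs
      linarith
  set M := ∫ y, evenGibbs f xs 1 y
  have hM : 0 ≤ M := integral_nonneg fun y => by
    simp only [evenGibbs, Pi.zero_apply]
    positivity
  have hG : ∀ α : ℝ, 0 < α →
      mconst f xs α * ∫ y, rexp (-(α / 2) * ‖A y‖ ^ 2) = 1 := fun α hα => by
    rw [integral_exp_neg_mul_norm_sq_comp_linearMap A hA (by positivity), mconst, ← hAdet,
      mul_mul_mul_comm, mul_inv_cancel₀ hA.ne', one_mul,
      ← Real.mul_rpow (by positivity) (by positivity)]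
    have : α / (2 * π) * (π / (α / 2)) = 1 := by
      field_simp
    rw [this, Real.one_rpow]
  set B := √(hess f xs).det * (1 / (2 * c)) ^ ((d : ℝ) / 2)
  have hB0 : 0 ≤ B := by positivity
  have hB : ∀ α : ℝ, 0 < α →
      mconst f xs α * ∫ y : E d, rexp (-(α * c) * ‖y‖ ^ 2) = B := fun α hα => by
    rw [GaussianFourier.integral_rexp_neg_mul_sq_norm (by positivity), finrank_euclideanSpace_fin,
      mconst, mul_assoc, ← Real.mul_rpow (by positivity) (by positivity)]
    congr 2
    field_simp
  have hdecay : ∃ α₁ : ℝ, ∀ α, α₁ ≤ α → mconst f xs α * rexp (-(α - 1) * η) ≤ 1 / α := by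
    have h := (tendsto_rpow_mul_exp_neg_mul_atTop_nhds_zero ((d : ℝ) / 2 + 1) η hη).const_mul
      (√(hess f xs).det * (1 / (2 * π)) ^ ((d : ℝ) / 2) * rexp η)
    rw [mul_zero] at h
    obtain ⟨α₁, h₁⟩ := Filter.eventually_atTop.1
      ((h.eventually_le_const one_pos).and (Filter.eventually_gt_atTop 0))
    refine ⟨α₁, fun α hα => ?_⟩
    obtain ⟨h₂, h₃⟩ := h₁ α hα
    rw [le_div_iff₀ h₃]
    refine le_trans (le_of_eq ?_) h₂
    rw [mconst, div_eq_mul_one_div α, Real.mul_rpow h₃.le (by positivity), Real.rpow_add h₃,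
      Real.rpow_one, show -(α - 1) * η = η + -η * α by ring, Real.exp_add]
    ring
  obtain ⟨α₁, hα₁⟩ := hdecay
  refine ⟨C * B + M + 1, by positivity, max 1 α₁, le_max_left _ _, fun α hα => ?_⟩
  have hα1 : 1 ≤ α := (le_max_left _ _).trans hα
  have hα0 : 0 < α := by linarith
  have hm := mconst_pos hpd hα0
  obtain ⟨hI, hIe⟩ := integrable_evenGibbs (xs := xs)
    (integrable_exp_neg_mul_of_one_le hf.continuous hmin' hfint hα1)
  obtain ⟨hI1, -⟩ := integrable_evenGibbs (xs := xs)
    (integrable_exp_neg_mul_of_one_le hf.continuous hmin' hfint le_rfl)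
  have hGi := integrable_exp_neg_mul_norm_sq_comp_linearMap A hA (half_pos hα0)
  have hBi := (integrable_exp_neg_mul_norm_sq (d := d) (mul_pos hα0 hc)).const_mul (C / α)
  have hlo := integral_mono (hGi.sub hBi) hI (hlower α hα0)
  have hGBi : Integrable fun y =>
      rexp (-(α / 2) * ‖A y‖ ^ 2) + C / α * rexp (-(α * c) * ‖y‖ ^ 2) := hGi.add hBi
  have hup := integral_mono hI (hGBi.add (hI1.const_mul _)) (hupper α hα1)
  simp only [Pi.sub_apply, Pi.add_apply] at hlo hup
  rw [integral_sub hGi hBi, integral_const_mul, hIe] at hlo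
  rw [integral_add hGBi (hI1.const_mul _), integral_add hGi hBi, integral_const_mul,
    integral_const_mul, hIe] at hup
  have hlo' := mul_le_mul_of_nonneg_left hlo hm.le
  have hup' := mul_le_mul_of_nonneg_left hup hm.le
  rw [mul_sub, hG α hα0, mul_left_comm, hB α hα0] at hlo'
  rw [mul_add, mul_add, hG α hα0, mul_left_comm _ (C / α), hB α hα0, ← mul_assoc _ _ M] at hup'
  have htail : mconst f xs α * rexp (-(α - 1) * η) * M ≤ 1 / α * M := by
    gcongr
    exact hα₁ α ((le_max_right _ _).trans hα)
  have hD : (C * B + M + 1) / α = C / α * B + 1 / α * M + 1 / α := by ring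
  have hp : 0 ≤ 1 / α * M := by positivity
  have hp' : 0 ≤ 1 / α := by positivity
  rw [hD, abs_le]
  constructor <;> linarith

/-- Bound on `Z_{2α}/Z_α²` for large `α`. The hypothesis `hinf` says that
`liminf_{‖x‖ → ∞} f x > f x⋆`, i.e. the minimum is not approached at infinity. -/
theorem stmt2 {d : ℕ} (hd : 1 ≤ d)
    (f : E d → ℝ) (xs : E d)
    (hf : ContDiff ℝ 4 f)
    (hmin : ∀ x, x ≠ xs → f xs < f x)
    (hinf : ∃ R : ℝ, ∃ η : ℝ, 0 < η ∧ ∀ x : E d, R ≤ ‖x‖ → f xs + η ≤ f x)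
    (hpd : (hess f xs).PosDef)
    (hfint : Integrable fun x => Real.exp (-f x)) :
    ∃ C : ℝ, 0 < C ∧ ∃ αt : ℝ, 1 < αt ∧ ∀ α : ℝ, αt ≤ α →
      Zc f (2 * α) / (Zc f α) ^ 2 ≤
        (2 : ℝ) ^ (-(d : ℝ) / 2) * mconst f xs α * (1 + 8 * C / α) := by
  obtain ⟨D, hD, α₀, hα₀, h⟩ := exists_abs_mconst_mul_Zc_sub_one_le hf hmin hinf hpd hfint
  refine ⟨D, hD, max (α₀ + 1) (8 * D), lt_max_of_lt_left (by linarith), fun α hα => ?_⟩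
  have hα1 : α₀ + 1 ≤ α := (le_max_left _ _).trans hα
  have hα2 : 8 * D ≤ α := (le_max_right _ _).trans hα
  have hα0 : 0 < α := by linarith
  set m := mconst f xs α with hm_def
  have hm : 0 < m := mconst_pos hpd hα0
  have hm2 : mconst f xs (2 * α) = 2 ^ ((d : ℝ) / 2) * m := by
    rw [hm_def, mconst, mconst, mul_div_assoc, Real.mul_rpow (by norm_num) (by positivity)]
    ring
  set p : ℝ := 2 ^ ((d : ℝ) / 2) with hp_def
  have hp : 0 < p := by positivity
  have hpinv : (2 : ℝ) ^ (-(d : ℝ) / 2) = p⁻¹ := by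
    rw [neg_div, Real.rpow_neg (by norm_num)]
  have h1 := (abs_le.1 (h α (by linarith))).1
  have h2 := (abs_le.1 (h (2 * α) (by linarith))).2
  rw [hm2] at h2
  set s := D / α with hs
  have hs0 : 0 < s := by positivity
  have hs8 : s ≤ 1 / 8 := by rw [hs, div_le_iff₀ hα0]; linarith
  have e2 : D / (2 * α) = s / 2 := by rw [hs]; field_simp
  rw [e2] at h2
  set u := rexp (α * f xs) with hu_def
  have hu : 0 < u := Real.exp_pos _
  have hu2 : rexp (2 * α * f xs) = u ^ 2 := by
    rw [hu_def, ← Real.exp_nat_mul]; congr 1; push_cast; ring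
  rw [hu2] at h2
  have hZ : 0 < Zc f α := by
    have : 0 < m * (u * Zc f α) := by linarith
    exact (mul_pos_iff_of_pos_left hu).1 ((mul_pos_iff_of_pos_left hm).1 this)
  have e8 : 8 * D / α = 8 * s := by rw [hs]; ring
  rw [e8, hpinv, div_le_iff₀ (by positivity)]
  have hsq : (1 - s) ^ 2 ≤ (m * (u * Zc f α)) ^ 2 :=
    pow_le_pow_left₀ (by linarith) (by linarith) 2
  have hfin : p * m * (u ^ 2 * Zc f (2 * α)) ≤ (1 + 8 * s) * (m * (u * Zc f α)) ^ 2 := by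
    calc p * m * (u ^ 2 * Zc f (2 * α)) ≤ 1 + s / 2 := by linarith
      _ ≤ (1 + 8 * s) * (1 - s) ^ 2 := by
        nlinarith [mul_nonneg hs0.le (sub_nonneg.2 hs8), pow_pos hs0 3]
      _ ≤ _ := by gcongr
  have hpos : 0 < p * m * u ^ 2 := by positivity
  refine le_of_mul_le_mul_left ?_ hpos
  calc p * m * u ^ 2 * Zc f (2 * α) = p * m * (u ^ 2 * Zc f (2 * α)) := by ring
    _ ≤ _ := hfin
    _ = _ := by field_simp
end

section
/- Let $d,q\ge 1$. Let $f:\mathbb R^d\to\mathbb R$ be four times continuously differentiable with a unique global minimizer $x^\star$, with $\liminf_{\|x\|\to\infty} f(x) > f(x^\star)$, with positive-definite Hessian $H:=H_f(x^\star)$, and with $\int_{\mathbb R^d} e^{-f(x)}\,dx<\infty$. For $\alpha>0$ put $Z_\alpha:=\int_{\mathbb R^d} e^{-\alpha f(x)}\,dx$ and $m_\alpha:=\sqrt{\det H}\,\bigl(\tfrac{\alpha}{2\pi}\bigr)^{d/2}$. For a twice continuously differentiable $\psi:\mathbb R^d\to\mathbb R$ put $$C_{f,\psi}:=\Bigl|\operatorname{Tr}\bigl(H^{-1}H_\psi(x^\star)\bigr)-\bigl\langle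 H^{-1}\nabla\psi(x^\star),\,T\bigr\rangle\Bigr|,\qquad T_i:=\sum_{k,l=1}^d (H^{-1})_{kl}\,\partial_i\partial_k\partial_l f(x^\star)$$ (so that $C_{f,\psi}=\bigl|\operatorname{Tr}(H_\psi(x^\star))-\sum_{i,k}\partial_i\psi(x^\star)\,\partial_i\partial_k\partial_k f(x^\star)\bigr|$ if $H$ is the identity). Let $\varphi:\mathbb R^d\to\mathbb R^q$ be measurable and let $q_0$ be a twice continuously differentiable probability density, positive on all of $\mathbb R^d$, such that for some $c_0>0$ one has $e^{-(f(x)-f(x^\star))}\le c_0\,q_0(x)$ for all $x$. Assume $\int e^{-(f(y)-f(x^\star))}\|\varphi(y)\|^2\,dy<\infty$ and $\int\|\varphi(y)\|^4q_0(y)\,dy<\infty$. With $\bar\varphi:=\varphi-\varphi(x^\star)$, assume that $\|\varphi\|^2/q_0$, $\|\bar\varphi\|^2/q_0$ and $1/q_0$ are twice continuously differentiable and that $C_{f,\|\varphi\|^2/q_0}$, $C_{f,\|\bar\varphi\|^2/q_0}$ and $C_{f,1/q_0}$ are positive. Let $X$ be a random vector with density $q_0$ and, for $\alpha>0$, set $\bar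 w:=e^{-\alpha f(X)}/\bigl(Z_\alpha\,q_0(X)\bigr)$. Then there exist a constant $C_1>0$, depending only on $f$, and a constant $\tilde\alpha>1$, depending only on $f$, $q_0$ and $\varphi$, such that for every $\alpha\ge\tilde\alpha$ the random variable $\|\bar w\,\varphi(X)\|^2$ is integrable and $$\mathbb E\bigl\|\bar w\,\varphi(X)\bigr\|^2\;\le\;2^{-d/2}\,m_\alpha\left(\frac{\|\varphi(x^\star)\|^2}{q_0(x^\star)}+\frac{C_{f,\|\varphi\|^2/q_0}}{2\alpha}\right)\left(1+\frac{C_1}{\alpha}\right).$$ -/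
open MeasureTheory ProbabilityTheory

noncomputable section

namespace Laplace

/-- `ℝ^d` with its Euclidean norm. -/
abbrev E (d : ℕ) := EuclideanSpace ℝ (Fin d)

/-- The `i`-th standard basis vector of `ℝ^d`. -/
def bvec (d : ℕ) (i : Fin d) : E d := EuclideanSpace.single i 1

/-- The normalizing constant `Z_α = ∫ exp (-α f)`. -/
def Zc {d : ℕ} (f : E d → ℝ) (α : ℝ) : ℝ := ∫ x, Real.exp (-α * f x)

/-- The gradient of `ψ` at `x` in coordinates, `(∂_i ψ(x))_i`. -/
def grad {d : ℕ} (ψ : E d → ℝ) (x : E d) : Fin d → ℝ :=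
  fun i => fderiv ℝ ψ x (bvec d i)

/-- The Hessian matrix `(∂_i ∂_j ψ(x))_{ij}`. -/
def hess {d : ℕ} (ψ : E d → ℝ) (x : E d) : Matrix (Fin d) (Fin d) ℝ :=
  Matrix.of fun i j => iteratedFDeriv ℝ 2 ψ x ![bvec d i, bvec d j]

/-- `m_α = √(det H_f(x)) (α/(2π))^{d/2}`. -/
def mconst {d : ℕ} (f : E d → ℝ) (x : E d) (α : ℝ) : ℝ :=
  Real.sqrt (hess f x).det * (α / (2 * Real.pi)) ^ ((d : ℝ) / 2)

/-- The partial trace of `D³f(x)` in the metric `H_f(x)`: the vector with `i`-th entry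
`∑_{k,l} (H_f(x)⁻¹)_{kl} ∂_i∂_k∂_l f(x)`. If `H_f(x) = 1` it is `∑_k ∂_i∂_k∂_k f(x)`. -/
def ptr3 {d : ℕ} (f : E d → ℝ) (x : E d) : Fin d → ℝ :=
  fun i => ∑ k, ∑ l, (hess f x)⁻¹ k l * iteratedFDeriv ℝ 3 f x ![bvec d i, bvec d k, bvec d l]

/-- The Laplace constant of a scalar function `ψ`:
`C_{f,ψ} = |Tr(H_f⁻¹ H_ψ) - ⟨H_f⁻¹ ∇ψ, PTr(D³f)⟩|`, everything at the point `x`.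
If `H_f(x) = 1` it is `|Tr(H_ψ) - ⟨∇ψ, PTr(D³f)⟩|`. -/
def lapC {d : ℕ} (f : E d → ℝ) (x : E d) (ψ : E d → ℝ) : ℝ :=
  |((hess f x)⁻¹ * hess ψ x).trace - ((hess f x)⁻¹.mulVec (grad ψ x)) ⬝ᵥ ptr3 f x|

/-- The standing assumptions on the objective `f` and its minimizer `xs`. -/
structure IsObjective {d : ℕ} (f : E d → ℝ) (xs : E d) : Prop where
  contDiff : ContDiff ℝ 4 f
  /-- `xs` is the unique global minimizer. -/
  unique_min : ∀ x, x ≠ xs → f xs < f x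
  /-- The minimal value is not approached at infinity: `liminf_{‖x‖ → ∞} f(x) > f(xs)`. -/
  separated : ∃ η > 0, ∃ R : ℝ, ∀ x, R ≤ ‖x‖ → f xs + η ≤ f x
  posDef : (hess f xs).PosDef
  integrable : Integrable fun x => Real.exp (-f x)

/-- The assumptions on the sampling density `q₀` and the test function `φ`. -/
structure IsProposal {d q : ℕ} (f : E d → ℝ) (xs : E d) (q₀ : E d → ℝ) (φ : E d → E q) :
    Prop where
  measurable : Measurable φ
  contDiff : ContDiff ℝ 2 q₀
  pos : ∀ x, 0 < q₀ x
  integrable : Integrable q₀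
  integral_eq_one : ∫ x, q₀ x = 1
  dominates : ∃ c₀ > 0, ∀ x, Real.exp (-(f x - f xs)) ≤ c₀ * q₀ x
  integrable_sq : Integrable fun y => Real.exp (-(f y - f xs)) * ‖φ y‖ ^ 2
  integrable_four : Integrable fun y => ‖φ y‖ ^ 4 * q₀ y
  contDiff_sq : ContDiff ℝ 2 fun x => ‖φ x‖ ^ 2 / q₀ x
  contDiff_bar : ContDiff ℝ 2 fun x => ‖φ x - φ xs‖ ^ 2 / q₀ x
  contDiff_inv : ContDiff ℝ 2 fun x => 1 / q₀ x
  lapC_sq : 0 < lapC f xs fun x => ‖φ x‖ ^ 2 / q₀ x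
  lapC_bar : 0 < lapC f xs fun x => ‖φ x - φ xs‖ ^ 2 / q₀ x
  lapC_inv : 0 < lapC f xs fun x => 1 / q₀ x

/-- The normalized importance weight `exp(-α f(x)) / (Z_α q₀(x))`. -/
def weight {d : ℕ} (f q₀ : E d → ℝ) (α : ℝ) (x : E d) : ℝ :=
  Real.exp (-α * f x) / (Zc f α * q₀ x)

end Laplace

end

noncomputable section

namespace Laplace

open Filter Topology Matrix

/-! ### Scaling and tail estimates -/

section

lemma exp_neg_taylor_bound (t : ℝ) (ht : 0 ≤ t) :
    0 ≤ Real.exp (-t) - 1 + t ∧ Real.exp (-t) - 1 + t ≤ t ^ 2 := by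
  have h1 := Real.add_one_le_exp (-t)
  have h2 := Real.add_one_le_exp t
  refine ⟨by linarith, ?_⟩
  have h3 : Real.exp (-t) * Real.exp t = 1 := by rw [← Real.exp_add]; simp
  have h4 := Real.exp_pos (-t)
  have h5 : Real.exp (-t) * (t + 1) ≤ 1 := (mul_le_mul_of_nonneg_left h2 h4.le).trans_eq h3
  nlinarith [pow_nonneg ht 3]

lemma abs_exp_neg_sub_exp_neg_le {a b m : ℝ} (ha : m ≤ a) (hb : m ≤ b) :
    |Real.exp (-a) - Real.exp (-b)| ≤ |a - b| * Real.exp (-m) := by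
  wlog h : a ≤ b generalizing a b
  · rw [abs_sub_comm, abs_sub_comm a]
    exact this hb ha (le_of_not_ge h)
  have h1 : Real.exp (-b) = Real.exp (-a) * Real.exp (-(b - a)) := by
    rw [← Real.exp_add]; ring_nf
  have h2 := Real.add_one_le_exp (-(b - a))
  have h3 : Real.exp (-b) ≤ Real.exp (-a) := Real.exp_le_exp.2 (by linarith)
  have h4 : Real.exp (-a) ≤ Real.exp (-m) := Real.exp_le_exp.2 (by linarith)
  rw [abs_of_nonneg (by linarith), abs_sub_comm, abs_of_nonneg (by linarith)]
  calc _ = Real.exp (-a) * (1 - Real.exp (-(b - a))) := by rw [h1]; ring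
    _ ≤ Real.exp (-a) * (b - a) :=
        mul_le_mul_of_nonneg_left (by linarith) (Real.exp_nonneg _)
    _ ≤ Real.exp (-m) * (b - a) := mul_le_mul_of_nonneg_right h4 (by linarith)
    _ = _ := mul_comm _ _

lemma abs_exp_neg_sub_linearization_le {a b m : ℝ} (ha : m ≤ a) (hb : m ≤ b) :
    |Real.exp (-a) - Real.exp (-b) + Real.exp (-b) * (a - b)| ≤ (a - b) ^ 2 * Real.exp (-m) := by
  have hb' : Real.exp (-b) ≤ Real.exp (-m) := Real.exp_le_exp.2 (by linarith)
  have ha' : Real.exp (-a) ≤ Real.exp (-m) := Real.exp_le_exp.2 (by linarith)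
  rcases le_total b a with h | h
  · have h1 : Real.exp (-a) = Real.exp (-b) * Real.exp (-(a - b)) := by
      rw [← Real.exp_add]; ring_nf
    obtain ⟨h2, h3⟩ := exp_neg_taylor_bound (a - b) (by linarith)
    rw [show Real.exp (-a) - Real.exp (-b) + Real.exp (-b) * (a - b)
      = Real.exp (-b) * (Real.exp (-(a - b)) - 1 + (a - b)) by rw [h1]; ring,
      abs_of_nonneg (by positivity), mul_comm]
    gcongr
  · have h1 : Real.exp (-b) = Real.exp (-a) * Real.exp (-(b - a)) := by
      rw [← Real.exp_add]; ring_nf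
    have h2 := Real.add_one_le_exp (-(b - a))
    have h3 := Real.add_one_le_exp (b - a)
    have h4 : Real.exp (-(b - a)) * Real.exp (b - a) = 1 := by rw [← Real.exp_add]; simp
    have h5 : Real.exp (-(b - a)) * (b - a + 1) ≤ 1 :=
      (mul_le_mul_of_nonneg_left h3 (Real.exp_nonneg _)).trans_eq h4
    rw [show Real.exp (-a) - Real.exp (-b) + Real.exp (-b) * (a - b)
      = Real.exp (-a) * (1 - Real.exp (-(b - a)) * (b - a + 1)) by rw [h1]; ring,
      abs_of_nonneg (by have := Real.exp_pos (-a); nlinarith), mul_comm]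
    have : 1 - Real.exp (-(b - a)) * (b - a + 1) ≤ (a - b) ^ 2 := by nlinarith
    gcongr

variable {V : Type*} [NormedAddCommGroup V] [InnerProductSpace ℝ V] [FiniteDimensional ℝ V]
  [MeasurableSpace V] [BorelSpace V]

lemma integrable_exp_neg_mul_norm_sq {κ : ℝ} (hκ : 0 < κ) :
    Integrable fun y : V => Real.exp (-(κ * ‖y‖ ^ 2)) := by
  have h := (GaussianFourier.integrable_cexp_neg_mul_sq_norm_add
    (show 0 < (κ : ℂ).re from hκ) 0 (0 : V)).norm
  refine h.congr (ae_of_all _ fun y => ?_)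
  simp only [Complex.norm_exp]
  norm_cast
  simp

lemma integrable_norm_pow_mul_exp_neg (k : ℕ) {κ : ℝ} (hκ : 0 < κ) :
    Integrable fun y : V => ‖y‖ ^ k * Real.exp (-(κ * ‖y‖ ^ 2)) := by
  have hlim : Tendsto (fun r : ℝ => r ^ k * Real.exp (-((κ / 2) * r))) atTop (𝓝 0) := by
    have := Real.tendsto_pow_mul_exp_neg_atTop_nhds_zero k
    have h2 := (this.comp (tendsto_id.const_mul_atTop (half_pos hκ))).const_mul ((κ / 2)⁻¹ ^ k)
    simp only [mul_zero, Function.comp_def, id] at h2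
    refine h2.congr fun r => ?_
    rw [mul_pow, ← mul_assoc, ← mul_assoc, ← mul_pow, inv_mul_cancel₀ (half_pos hκ).ne', one_pow,
      one_mul]
  obtain ⟨R, hR⟩ := (hlim.eventually (gt_mem_nhds zero_lt_one)).exists_forall_of_atTop
  set C := max (1 : ℝ) (max R 1 ^ k)
  refine ((integrable_exp_neg_mul_norm_sq (V := V) (half_pos hκ)).const_mul C).mono'
    (by fun_prop) (ae_of_all _ fun y => ?_)
  rw [Real.norm_of_nonneg (by positivity)]
  have e : Real.exp (-(κ * ‖y‖ ^ 2))
      = Real.exp (-(κ / 2 * ‖y‖ ^ 2)) * Real.exp (-(κ / 2 * ‖y‖ ^ 2)) := by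
    rw [← Real.exp_add]; ring_nf
  rw [e, ← mul_assoc]
  gcongr
  by_cases hy : max R 1 ≤ ‖y‖
  · have h1 : ‖y‖ ≤ ‖y‖ ^ 2 := by nlinarith [le_max_right R 1]
    have h2 := hR (‖y‖ ^ 2) (by linarith [le_max_left R 1])
    refine le_trans ?_ (le_max_left _ _)
    refine le_trans ?_ h2.le
    gcongr
  · refine le_trans ?_ (le_max_right _ _)
    calc _ ≤ ‖y‖ ^ k * 1 := by
          gcongr
          exact Real.exp_le_one_iff.2 (by have : 0 ≤ κ / 2 * ‖y‖ ^ 2 := by positivity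
                                          linarith)
      _ ≤ _ := by rw [mul_one]; gcongr; exact (not_le.1 hy).le

open Module in
lemma pow_finrank_mul_setIntegral_ball (h : V → ℝ) {s : ℝ} (hs : 0 < s) (δ : ℝ) :
    s ^ finrank ℝ V * ∫ u in Metric.ball (0 : V) δ, h u
      = ∫ y in Metric.ball (0 : V) (s * δ), h (s⁻¹ • y) := by
  rw [← integral_indicator Metric.isOpen_ball.measurableSet,
    ← integral_indicator Metric.isOpen_ball.measurableSet]
  have := Measure.integral_comp_inv_smul (volume : Measure V)
    ((Metric.ball (0 : V) δ).indicator h) s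
  rw [abs_of_nonneg (by positivity), smul_eq_mul] at this
  rw [← this]
  congr 1 with y
  simp only [Set.indicator, Metric.mem_ball, dist_zero_right, norm_smul, norm_inv,
    Real.norm_of_nonneg hs.le]
  simp only [inv_mul_lt_iff₀ hs]

lemma setIntegral_ball_eq_zero_of_odd {h : V → ℝ} (hodd : ∀ y, h (-y) = -h y) (r : ℝ) :
    ∫ y in Metric.ball (0 : V) r, h y = 0 := by
  rw [← integral_indicator Metric.isOpen_ball.measurableSet]
  have h1 := integral_neg_eq_self ((Metric.ball (0 : V) r).indicator h) volume
  have h2 : ∀ y, (Metric.ball (0 : V) r).indicator h (-y)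
      = -(Metric.ball (0 : V) r).indicator h y := by
    intro y
    simp only [Set.indicator, Metric.mem_ball, dist_zero_right, norm_neg, hodd]
    split_ifs <;> simp
  simp only [h2, integral_neg] at h1
  linarith

lemma tendsto_pow_mul_exp_neg_sq {η : ℝ} (hη : 0 < η) (m : ℝ) (k : ℕ) :
    Tendsto (fun s : ℝ => s ^ k * Real.exp (-((s ^ 2 - m) * η))) atTop (𝓝 0) := by
  have h1 := (Real.tendsto_pow_mul_exp_neg_atTop_nhds_zero k).comp
    (tendsto_id.const_mul_atTop hη)
  have h2 := h1.const_mul (η⁻¹ ^ k * Real.exp (m * η))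
  rw [mul_zero] at h2
  refine tendsto_of_tendsto_of_tendsto_of_le_of_le' tendsto_const_nhds h2 ?_ ?_
  · filter_upwards [eventually_ge_atTop 0] with s hs
    positivity
  · filter_upwards [eventually_ge_atTop 1] with s hs
    simp only [Function.comp_apply, id]
    have e : η⁻¹ ^ k * Real.exp (m * η) * ((η * s) ^ k * Real.exp (-(η * s)))
      = s ^ k * Real.exp (m * η - η * s) := by
      rw [sub_eq_add_neg, Real.exp_add, mul_pow]
      have : η⁻¹ ^ k * η ^ k = 1 := by rw [← mul_pow, inv_mul_cancel₀ hη.ne', one_pow]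
      linear_combination (s ^ k * Real.exp (m * η) * Real.exp (-(η * s))) * this
    rw [e]
    gcongr
    nlinarith [mul_nonneg hη.le (mul_nonneg (by linarith : 0 ≤ s) (by linarith : 0 ≤ s - 1))]

/-- Second-order model of a function `g` near its non-degenerate minimum at the origin: a quadratic
form `Q`, a cubic form `c`, a remainder of order four, and a gap away from the origin. -/
structure IsLaplaceModel (g Q c : V → ℝ) (κ δ η M : ℝ) : Prop where
  cont_g : Continuous g
  cont_Q : Continuous Q
  cont_c : Continuous c
  Q_smul : ∀ (t : ℝ) u, Q (t • u) = t ^ 2 * Q u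
  c_smul : ∀ (t : ℝ) u, c (t • u) = t ^ 3 * c u
  κ_pos : 0 < κ
  δ_pos : 0 < δ
  δ_le : δ ≤ 1
  η_pos : 0 < η
  M_nonneg : 0 ≤ M
  Q_ge : ∀ u, κ * ‖u‖ ^ 2 ≤ Q u
  g_ge : ∀ u, ‖u‖ < δ → κ * ‖u‖ ^ 2 ≤ g u
  g_far : ∀ u, δ ≤ ‖u‖ → η ≤ g u
  c_le : ∀ u, |c u| ≤ M * ‖u‖ ^ 3
  taylor : ∀ u, ‖u‖ < δ → |g u - Q u - c u| ≤ M * ‖u‖ ^ 4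
  integrable : Integrable fun u => Real.exp (-g u)

namespace IsLaplaceModel

variable {g Q c : V → ℝ} {κ δ η M : ℝ}

lemma g_nonneg (h : IsLaplaceModel g Q c κ δ η M) (u : V) : 0 ≤ g u := by
  rcases lt_or_ge ‖u‖ δ with hu | hu
  · have := h.g_ge u hu
    have := mul_nonneg h.κ_pos.le (sq_nonneg ‖u‖)
    linarith
  · linarith [h.g_far u hu, h.η_pos]

lemma scaled_ge (h : IsLaplaceModel g Q c κ δ η M) {s : ℝ} (hs : 0 < s) {y : V}
    (hy : ‖y‖ < s * δ) : κ * ‖y‖ ^ 2 ≤ s ^ 2 * g (s⁻¹ • y) := by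
  have hn : ‖s⁻¹ • y‖ = s⁻¹ * ‖y‖ := by rw [norm_smul, norm_inv, Real.norm_of_nonneg hs.le]
  have := h.g_ge (s⁻¹ • y) (by rw [hn, inv_mul_lt_iff₀ hs]; exact hy)
  rw [hn] at this
  calc _ = s ^ 2 * (κ * (s⁻¹ * ‖y‖) ^ 2) := by field_simp
    _ ≤ _ := by gcongr

lemma scaled_taylor (h : IsLaplaceModel g Q c κ δ η M) {s : ℝ} (hs : 0 < s) {y : V}
    (hy : ‖y‖ < s * δ) :
    |s ^ 2 * g (s⁻¹ • y) - Q y - c y / s| ≤ M * ‖y‖ ^ 4 / s ^ 2 := by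
  have hn : ‖s⁻¹ • y‖ = s⁻¹ * ‖y‖ := by rw [norm_smul, norm_inv, Real.norm_of_nonneg hs.le]
  have := h.taylor (s⁻¹ • y) (by rw [hn, inv_mul_lt_iff₀ hs]; exact hy)
  rw [hn, h.Q_smul, h.c_smul] at this
  calc _ = |s ^ 2 * (g (s⁻¹ • y) - s⁻¹ ^ 2 * Q y - s⁻¹ ^ 3 * c y)| := by
        congr 1; field_simp
    _ = s ^ 2 * |g (s⁻¹ • y) - s⁻¹ ^ 2 * Q y - s⁻¹ ^ 3 * c y| := by
        rw [abs_mul, abs_of_nonneg (by positivity : 0 ≤ s ^ 2)]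
    _ ≤ s ^ 2 * (M * (s⁻¹ * ‖y‖) ^ 4) := by gcongr
    _ = _ := by field_simp

lemma scaled_taylor_three (h : IsLaplaceModel g Q c κ δ η M) {s : ℝ} (hs : 0 < s) {y : V}
    (hy : ‖y‖ < s * δ) :
    |s ^ 2 * g (s⁻¹ • y) - Q y| ≤ 2 * M * ‖y‖ ^ 3 / s := by
  have h1 := h.scaled_taylor hs hy
  have h2 : |c y / s| ≤ M * ‖y‖ ^ 3 / s := by
    rw [abs_div, abs_of_pos hs]; gcongr; exact h.c_le y
  have h3 : M * ‖y‖ ^ 4 / s ^ 2 ≤ M * ‖y‖ ^ 3 / s := by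
    rw [div_le_div_iff₀ (by positivity) hs]
    have : ‖y‖ ≤ s := hy.le.trans (by nlinarith [h.δ_le])
    have := mul_le_mul_of_nonneg_left this (by have := h.M_nonneg; positivity :
      0 ≤ M * ‖y‖ ^ 3 * s)
    nlinarith
  calc _ = |(s ^ 2 * g (s⁻¹ • y) - Q y - c y / s) + c y / s| := by ring_nf
    _ ≤ _ := abs_add_le _ _
    _ ≤ M * ‖y‖ ^ 3 / s + M * ‖y‖ ^ 3 / s := by linarith
    _ = _ := by ring

lemma integrable_norm_pow_mul_exp_neg_Q (h : IsLaplaceModel g Q c κ δ η M) (k : ℕ) :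
    Integrable fun y => ‖y‖ ^ k * Real.exp (-Q y) := by
  have := h.cont_Q
  refine (integrable_norm_pow_mul_exp_neg (V := V) k h.κ_pos).mono' (by fun_prop)
    (ae_of_all _ fun y => ?_)
  rw [Real.norm_of_nonneg (by positivity)]
  gcongr
  exact h.Q_ge y

lemma integrable_exp_neg_Q (h : IsLaplaceModel g Q c κ δ η M) :
    Integrable fun y => Real.exp (-Q y) := by
  simpa using h.integrable_norm_pow_mul_exp_neg_Q 0

lemma integrable_exp_neg_mul (h : IsLaplaceModel g Q c κ δ η M) {ψ : V → ℝ} {m b : ℝ}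
    (hψ : AEStronglyMeasurable ψ) (hint : Integrable fun u => Real.exp (-(m * g u)) * ψ u)
    (hb : m ≤ b) : Integrable fun u => Real.exp (-(b * g u)) * ψ u := by
  have hg := h.cont_g
  refine hint.norm.mono'
    ((by fun_prop : Continuous fun u => Real.exp (-(b * g u))).aestronglyMeasurable.mul hψ)
    (ae_of_all _ fun u => ?_)
  rw [norm_mul, norm_mul, Real.norm_of_nonneg (Real.exp_nonneg _),
    Real.norm_of_nonneg (Real.exp_nonneg _)]
  gcongr
  exact h.g_nonneg u

lemma tendsto_tail (h : IsLaplaceModel g Q c κ δ η M) {ψ : V → ℝ} {m : ℝ}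
    (hint : Integrable fun u => Real.exp (-(m * g u)) * ψ u) (k : ℕ) :
    Tendsto (fun s : ℝ => s ^ k * ∫ u in (Metric.ball (0 : V) δ)ᶜ,
      Real.exp (-(s ^ 2 * g u)) * ψ u) atTop (𝓝 0) := by
  have h1 := (tendsto_pow_mul_exp_neg_sq h.η_pos m k).mul_const
    (∫ u, ‖Real.exp (-(m * g u)) * ψ u‖)
  rw [zero_mul] at h1
  refine squeeze_zero_norm' ?_ h1
  have hs2 : ∀ᶠ s : ℝ in atTop, m ≤ s ^ 2 :=
    (tendsto_pow_atTop two_ne_zero).eventually_ge_atTop m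
  filter_upwards [hs2, eventually_ge_atTop 0] with s hs hs0
  rw [norm_mul, Real.norm_of_nonneg (pow_nonneg hs0 k), mul_assoc]
  gcongr
  refine (norm_integral_le_integral_norm _).trans ?_
  calc _ ≤ ∫ u in (Metric.ball (0 : V) δ)ᶜ,
        Real.exp (-((s ^ 2 - m) * η)) * ‖Real.exp (-(m * g u)) * ψ u‖ := by
        refine integral_mono_of_nonneg (ae_of_all _ fun _ => norm_nonneg _)
          (hint.norm.const_mul _).integrableOn ?_
        filter_upwards [ae_restrict_mem Metric.isOpen_ball.measurableSet.compl] with u hu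
        have hu' := h.g_far u (by simpa using hu)
        simp only [norm_mul, Real.norm_of_nonneg (Real.exp_nonneg _)]
        rw [← mul_assoc, ← Real.exp_add]
        gcongr
        nlinarith
    _ ≤ ∫ u, Real.exp (-((s ^ 2 - m) * η)) * ‖Real.exp (-(m * g u)) * ψ u‖ :=
        setIntegral_le_integral (hint.norm.const_mul _) (ae_of_all _ fun _ => by positivity)
    _ = _ := integral_const_mul _ _

end IsLaplaceModel

end

/-! ### Laplace asymptotics for a local model -/

section

variable {V : Type*} [NormedAddCommGroup V] [InnerProductSpace ℝ V] [FiniteDimensional ℝ V]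
  [MeasurableSpace V] [BorelSpace V]
namespace IsLaplaceModel

variable {g Q c : V → ℝ} {κ δ η M : ℝ}

lemma Q_neg (h : IsLaplaceModel g Q c κ δ η M) (y : V) : Q (-y) = Q y := by
  simpa using h.Q_smul (-1) y

lemma c_neg (h : IsLaplaceModel g Q c κ δ η M) (y : V) : c (-y) = -c y := by
  have := h.c_smul (-1) y
  norm_num at this
  exact this

lemma integrable_exp_neg_Q_mul (h : IsLaplaceModel g Q c κ δ η M) {p : V → ℝ} (hp : Continuous p)
    {C : ℝ} {k : ℕ} (hC : ∀ y, |p y| ≤ C * ‖y‖ ^ k) :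
    Integrable fun y => Real.exp (-Q y) * p y := by
  have := h.cont_Q
  refine ((h.integrable_norm_pow_mul_exp_neg_Q k).const_mul C).mono' (by fun_prop)
    (ae_of_all _ fun y => ?_)
  rw [norm_mul, Real.norm_of_nonneg (Real.exp_nonneg _), Real.norm_eq_abs]
  calc _ ≤ Real.exp (-Q y) * (C * ‖y‖ ^ k) := by gcongr; exact hC y
    _ = _ := by ring

lemma scaled_remainder_le (h : IsLaplaceModel g Q c κ δ η M) {s : ℝ} (hs : 0 < s) {y : V}
    (hy : ‖y‖ < s * δ) :
    |Real.exp (-(s ^ 2 * g (s⁻¹ • y))) - Real.exp (-Q y) + s⁻¹ * (Real.exp (-Q y) * c y)| ≤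
      (s ^ 2)⁻¹ * (4 * M ^ 2 * (‖y‖ ^ 6 * Real.exp (-(κ * ‖y‖ ^ 2)))
        + M * (‖y‖ ^ 4 * Real.exp (-(κ * ‖y‖ ^ 2)))) := by
  set a := s ^ 2 * g (s⁻¹ • y)
  have h1 := abs_exp_neg_sub_linearization_le (h.scaled_ge hs hy) (h.Q_ge y)
  have h2 := h.scaled_taylor hs hy
  have h3 := h.scaled_taylor_three hs hy
  have h4 : (a - Q y) ^ 2 ≤ (2 * M * ‖y‖ ^ 3 / s) ^ 2 := by
    rw [← sq_abs]; gcongr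
  calc _ = |(Real.exp (-a) - Real.exp (-Q y) + Real.exp (-Q y) * (a - Q y))
        - Real.exp (-Q y) * (a - Q y - c y / s)| := by congr 1; field_simp; ring
    _ ≤ |Real.exp (-a) - Real.exp (-Q y) + Real.exp (-Q y) * (a - Q y)|
        + |Real.exp (-Q y) * (a - Q y - c y / s)| := abs_sub _ _
    _ ≤ (2 * M * ‖y‖ ^ 3 / s) ^ 2 * Real.exp (-(κ * ‖y‖ ^ 2))
        + Real.exp (-(κ * ‖y‖ ^ 2)) * (M * ‖y‖ ^ 4 / s ^ 2) := by
        refine add_le_add (h1.trans (by gcongr)) ?_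
        rw [abs_mul, Real.abs_exp]
        gcongr
        exact h.Q_ge y
    _ = _ := by field_simp; ring

open Module in
/-- Laplace's method for the normalizing constant, with relative error `O(s⁻²)`. -/
theorem normalizer_asymptotics (h : IsLaplaceModel g Q c κ δ η M) :
    ∃ K : ℝ, 0 ≤ K ∧ ∀ᶠ s : ℝ in atTop,
      |s ^ finrank ℝ V * (∫ u, Real.exp (-(s ^ 2 * g u))) - ∫ y, Real.exp (-Q y)| ≤ K / s ^ 2 := by
  have hgc := h.cont_g
  have hQc := h.cont_Q
  have hcc := h.cont_c
  have hint1 : Integrable fun u => Real.exp (-(1 * g u)) * (1 : ℝ) := by simpa using h.integrable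
  set w : V → ℝ := fun y => 4 * M ^ 2 * (‖y‖ ^ 6 * Real.exp (-(κ * ‖y‖ ^ 2)))
        + M * (‖y‖ ^ 4 * Real.exp (-(κ * ‖y‖ ^ 2))) with hw
  have hwint : Integrable w :=
    ((integrable_norm_pow_mul_exp_neg 6 h.κ_pos).const_mul _).add
      ((integrable_norm_pow_mul_exp_neg 4 h.κ_pos).const_mul _)
  have hw0 : ∀ y, 0 ≤ w y := fun y => by have := h.M_nonneg; positivity
  set K2 := (δ ^ 2)⁻¹ * ∫ y, ‖y‖ ^ 2 * Real.exp (-Q y)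
  have hcint : Integrable fun y => Real.exp (-Q y) * c y :=
    h.integrable_exp_neg_Q_mul h.cont_c h.c_le
  refine ⟨1 + (∫ y, w y) + K2, ?_, ?_⟩
  · have h1 : 0 ≤ ∫ y, w y := integral_nonneg hw0
    have h2 : 0 ≤ ∫ y, ‖y‖ ^ 2 * Real.exp (-Q y) := integral_nonneg fun y => by positivity
    positivity
  have htail := (h.tendsto_tail hint1 (finrank ℝ V + 2)).norm.eventually
    (gt_mem_nhds (by simp : ‖(0 : ℝ)‖ < 1))
  filter_upwards [htail, eventually_ge_atTop 1] with s hts hs1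
  have hs : 0 < s := by linarith
  have hsq : 1 ≤ s ^ 2 := by nlinarith
  have hbm : MeasurableSet (Metric.ball (0 : V) δ) := Metric.isOpen_ball.measurableSet
  have hbsm : MeasurableSet (Metric.ball (0 : V) (s * δ)) := Metric.isOpen_ball.measurableSet
  have hgint : Integrable fun u => Real.exp (-(s ^ 2 * g u)) := by
    simpa using h.integrable_exp_neg_mul aestronglyMeasurable_const hint1 hsq
  have hsplit := integral_add_compl hbm hgint
  have hsplitQ := integral_add_compl hbsm h.integrable_exp_neg_Q
  have hscale := pow_finrank_mul_setIntegral_ball (fun u : V => Real.exp (-(s ^ 2 * g u))) hs δ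
  have hodd : ∫ y in Metric.ball (0 : V) (s * δ), Real.exp (-Q y) * c y = 0 :=
    setIntegral_ball_eq_zero_of_odd (fun y => by rw [h.Q_neg, h.c_neg]; ring) _
  have hE1 : IntegrableOn (fun y => Real.exp (-(s ^ 2 * g (s⁻¹ • y))))
      (Metric.ball (0 : V) (s * δ)) :=
    ((by fun_prop : Continuous fun y => Real.exp (-(s ^ 2 * g (s⁻¹ • y)))).continuousOn.integrableOn_compact
      (isCompact_closedBall (0 : V) (s * δ))).mono_set Metric.ball_subset_closedBall
  have hnear : |(∫ y in Metric.ball (0 : V) (s * δ), Real.exp (-(s ^ 2 * g (s⁻¹ • y))))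
      - ∫ y in Metric.ball (0 : V) (s * δ), Real.exp (-Q y)| ≤ (∫ y, w y) / s ^ 2 := by
    have e : (∫ y in Metric.ball (0 : V) (s * δ), Real.exp (-(s ^ 2 * g (s⁻¹ • y))))
      - ∫ y in Metric.ball (0 : V) (s * δ), Real.exp (-Q y)
      = ∫ y in Metric.ball (0 : V) (s * δ), (Real.exp (-(s ^ 2 * g (s⁻¹ • y)))
        - Real.exp (-Q y) + s⁻¹ * (Real.exp (-Q y) * c y)) := by
      rw [integral_add, integral_sub hE1 h.integrable_exp_neg_Q.integrableOn, integral_const_mul,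
        hodd, mul_zero, add_zero]
      · exact hE1.sub h.integrable_exp_neg_Q.integrableOn
      · exact (hcint.const_mul _).integrableOn
    rw [e, ← Real.norm_eq_abs]
    refine (norm_integral_le_integral_norm _).trans ?_
    calc _ ≤ ∫ y in Metric.ball (0 : V) (s * δ), (s ^ 2)⁻¹ * w y := by
          refine integral_mono_of_nonneg (ae_of_all _ fun _ => norm_nonneg _)
            (hwint.const_mul _).integrableOn ?_
          filter_upwards [ae_restrict_mem hbsm] with y hy
          exact h.scaled_remainder_le hs (by simpa using hy)
      _ ≤ ∫ y, (s ^ 2)⁻¹ * w y :=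
          setIntegral_le_integral (hwint.const_mul _)
            (ae_of_all _ fun y => mul_nonneg (by positivity) (hw0 y))
      _ = _ := by rw [integral_const_mul]; ring
  have hfar : |∫ y in (Metric.ball (0 : V) (s * δ))ᶜ, Real.exp (-Q y)| ≤ K2 / s ^ 2 := by
    have hi := h.integrable_norm_pow_mul_exp_neg_Q 2
    rw [← Real.norm_eq_abs]
    refine (norm_integral_le_integral_norm _).trans ?_
    calc _ ≤ ∫ y in (Metric.ball (0 : V) (s * δ))ᶜ,
          ((s * δ) ^ 2)⁻¹ * (‖y‖ ^ 2 * Real.exp (-Q y)) := by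
          refine integral_mono_of_nonneg (ae_of_all _ fun _ => norm_nonneg _)
            (hi.const_mul _).integrableOn ?_
          filter_upwards [ae_restrict_mem hbsm.compl] with y hy
          have hy' : s * δ ≤ ‖y‖ := by simpa using hy
          have hsd : 0 < s * δ := mul_pos hs h.δ_pos
          simp only [Real.norm_of_nonneg (Real.exp_nonneg _)]
          rw [← mul_assoc]
          refine le_mul_of_one_le_left (Real.exp_nonneg _) ?_
          rw [← div_eq_inv_mul, one_le_div (by positivity)]
          gcongr
      _ ≤ ∫ y, ((s * δ) ^ 2)⁻¹ * (‖y‖ ^ 2 * Real.exp (-Q y)) :=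
          setIntegral_le_integral (hi.const_mul _) (ae_of_all _ fun y => by positivity)
      _ = _ := by rw [integral_const_mul, mul_pow]; simp only [K2]; field_simp
  have ht : |s ^ finrank ℝ V * ∫ u in (Metric.ball (0 : V) δ)ᶜ, Real.exp (-(s ^ 2 * g u))|
      ≤ 1 / s ^ 2 := by
    rw [le_div_iff₀ (by positivity)]
    rw [Real.norm_eq_abs] at hts
    simp only [mul_one] at hts
    rw [← abs_of_nonneg (by positivity : 0 ≤ s ^ 2), ← abs_mul]
    rw [pow_add] at hts
    refine le_trans (le_of_eq ?_) hts.le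
    rw [abs_of_nonneg (by positivity : 0 ≤ s ^ 2)]
    ring_nf
  rw [← hsplit, ← hsplitQ, mul_add, hscale]
  rw [abs_le] at *
  have : (1 + (∫ y, w y) + K2) / s ^ 2 = 1 / s ^ 2 + (∫ y, w y) / s ^ 2 + K2 / s ^ 2 := by ring
  rw [this]
  constructor <;> linarith [hnear.1, hnear.2, hfar.1, hfar.2, ht.1, ht.2]

lemma tendsto_scaled (h : IsLaplaceModel g Q c κ δ η M) (y : V) :
    Tendsto (fun s : ℝ => s ^ 2 * g (s⁻¹ • y)) atTop (𝓝 (Q y)) := by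
  have h0 : Tendsto (fun s : ℝ => 2 * M * ‖y‖ ^ 3 / s) atTop (𝓝 0) :=
    tendsto_const_nhds.div_atTop tendsto_id
  rw [tendsto_iff_norm_sub_tendsto_zero]
  refine squeeze_zero' (Eventually.of_forall fun _ => norm_nonneg _) ?_ h0
  filter_upwards [eventually_gt_atTop 0, eventually_gt_atTop (‖y‖ / δ)] with s hs hs'
  exact h.scaled_taylor_three hs ((div_lt_iff₀ h.δ_pos).1 hs')

lemma tendsto_scaled_cubic (h : IsLaplaceModel g Q c κ δ η M) (y : V) :
    Tendsto (fun s : ℝ => s * (Real.exp (-(s ^ 2 * g (s⁻¹ • y))) - Real.exp (-Q y))) atTop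
      (𝓝 (-(Real.exp (-Q y) * c y))) := by
  set W := 4 * M ^ 2 * (‖y‖ ^ 6 * Real.exp (-(κ * ‖y‖ ^ 2)))
        + M * (‖y‖ ^ 4 * Real.exp (-(κ * ‖y‖ ^ 2)))
  have h0 : Tendsto (fun s : ℝ => W / s) atTop (𝓝 0) :=
    tendsto_const_nhds.div_atTop tendsto_id
  rw [tendsto_iff_norm_sub_tendsto_zero]
  refine squeeze_zero' (Eventually.of_forall fun _ => norm_nonneg _) ?_ h0
  filter_upwards [eventually_gt_atTop 0, eventually_gt_atTop (‖y‖ / δ)] with s hs hs'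
  have := h.scaled_remainder_le hs ((div_lt_iff₀ h.δ_pos).1 hs')
  calc _ = s * |Real.exp (-(s ^ 2 * g (s⁻¹ • y))) - Real.exp (-Q y)
        + s⁻¹ * (Real.exp (-Q y) * c y)| := by
        rw [← abs_of_pos hs, ← abs_mul, abs_of_pos hs, Real.norm_eq_abs]
        congr 1; field_simp; ring
    _ ≤ s * ((s ^ 2)⁻¹ * W) := by gcongr
    _ = _ := by field_simp

open Module in
/-- Laplace's method at first order for an integrand that vanishes at the minimum. -/
theorem tendsto_integral_of_vanishing (h : IsLaplaceModel g Q c κ δ η M) {ψ p : V → ℝ}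
    (ℓ : V →L[ℝ] ℝ) {M' m : ℝ} (hψ : Continuous ψ)
    (hM' : ∀ u, ‖u‖ < δ → |ψ u - ℓ u| ≤ M' * ‖u‖ ^ 2)
    (hlim : ∀ y, Tendsto (fun s : ℝ => s ^ 2 * (ψ (s⁻¹ • y) - ℓ (s⁻¹ • y))) atTop (𝓝 (p y)))
    (hint : Integrable fun u => Real.exp (-(m * g u)) * ψ u) :
    Tendsto (fun s : ℝ => s ^ (finrank ℝ V + 2) * ∫ u, Real.exp (-(s ^ 2 * g u)) * ψ u) atTop
      (𝓝 (∫ y, Real.exp (-Q y) * (p y - c y * ℓ y))) := by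
  have hgc := h.cont_g
  have hQc := h.cont_Q
  have hbm : MeasurableSet (Metric.ball (0 : V) δ) := Metric.isOpen_ball.measurableSet
  set G : ℝ → V → ℝ := fun s y => Real.exp (-(s ^ 2 * g (s⁻¹ • y))) *
      (s ^ 2 * (ψ (s⁻¹ • y) - ℓ (s⁻¹ • y)))
      + s * (Real.exp (-(s ^ 2 * g (s⁻¹ • y))) - Real.exp (-Q y)) * ℓ y with hG
  have hGc : ∀ s, Continuous (G s) := fun s => by simp only [hG]; fun_prop
  set bd : V → ℝ := fun y => M' * (‖y‖ ^ 2 * Real.exp (-(κ * ‖y‖ ^ 2)))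
    + 2 * M * ‖ℓ‖ * (‖y‖ ^ 4 * Real.exp (-(κ * ‖y‖ ^ 2))) with hbd
  have hbdint : Integrable bd :=
    ((integrable_norm_pow_mul_exp_neg 2 h.κ_pos).const_mul _).add
      ((integrable_norm_pow_mul_exp_neg 4 h.κ_pos).const_mul _)
  have hbound : ∀ s : ℝ, 0 < s → ∀ y, ‖y‖ < s * δ → |G s y| ≤ bd y := by
    intro s hs y hy
    have hn : ‖s⁻¹ • y‖ = s⁻¹ * ‖y‖ := by rw [norm_smul, norm_inv, Real.norm_of_nonneg hs.le]
    have h1 := hM' (s⁻¹ • y) (by rw [hn, inv_mul_lt_iff₀ hs]; exact hy)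
    have h2 := h.scaled_ge hs hy
    have h3 := abs_exp_neg_sub_exp_neg_le h2 (h.Q_ge y)
    have h4 := h.scaled_taylor_three hs hy
    have h5 : |ℓ y| ≤ ‖ℓ‖ * ‖y‖ := ℓ.le_opNorm y
    refine (abs_add_le _ _).trans (add_le_add ?_ ?_)
    · rw [abs_mul, Real.abs_exp, abs_mul, abs_of_pos (by positivity : 0 < s ^ 2)]
      calc _ ≤ Real.exp (-(κ * ‖y‖ ^ 2)) * (s ^ 2 * (M' * ‖s⁻¹ • y‖ ^ 2)) := by gcongr
        _ = _ := by rw [hn]; field_simp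
    · rw [abs_mul, abs_mul, abs_of_pos hs]
      calc _ ≤ s * (2 * M * ‖y‖ ^ 3 / s * Real.exp (-(κ * ‖y‖ ^ 2))) * (‖ℓ‖ * ‖y‖) := by
            have := h.M_nonneg
            gcongr
            exact h3.trans (by gcongr)
        _ = _ := by field_simp
  have hDCT : Tendsto (fun s : ℝ => ∫ y, (Metric.ball (0 : V) (s * δ)).indicator (G s) y) atTop
      (𝓝 (∫ y, Real.exp (-Q y) * (p y - c y * ℓ y))) := by
    refine tendsto_integral_filter_of_dominated_convergence (fun y => |bd y|) ?_ ?_ hbdint.abs ?_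
    · exact Eventually.of_forall fun s =>
        (hGc s).aestronglyMeasurable.indicator Metric.isOpen_ball.measurableSet
    · filter_upwards [eventually_gt_atTop 0] with s hs
      refine ae_of_all _ fun y => ?_
      by_cases hy : y ∈ Metric.ball (0 : V) (s * δ)
      · rw [Set.indicator_of_mem hy]
        exact (hbound s hs y (by simpa using hy)).trans (le_abs_self _)
      · rw [Set.indicator_of_notMem hy]; simp
    · refine ae_of_all _ fun y => ?_
      have h1 : Tendsto (fun s => G s y) atTop (𝓝 (Real.exp (-Q y) * (p y - c y * ℓ y))) := by
        have e : Real.exp (-Q y) * (p y - c y * ℓ y)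
          = Real.exp (-Q y) * p y + -(Real.exp (-Q y) * c y) * ℓ y := by ring
        rw [e]
        exact (((Real.continuous_exp.tendsto _).comp (h.tendsto_scaled y).neg).mul (hlim y)).add
          ((h.tendsto_scaled_cubic y).mul_const _)
      refine h1.congr' ?_
      filter_upwards [eventually_gt_atTop (‖y‖ / δ)] with s hs'
      rw [Set.indicator_of_mem]
      simpa using (div_lt_iff₀ h.δ_pos).1 hs'
  have htail := h.tendsto_tail hint (finrank ℝ V + 2)
  have hsum := hDCT.add htail
  rw [add_zero] at hsum
  refine hsum.congr' ?_
  have hs2 : ∀ᶠ s : ℝ in atTop, m ≤ s ^ 2 :=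
    (tendsto_pow_atTop two_ne_zero).eventually_ge_atTop m
  filter_upwards [hs2, eventually_gt_atTop 0] with s hsm hs
  have hgint := h.integrable_exp_neg_mul hψ.aestronglyMeasurable hint hsm
  rw [← integral_add_compl hbm hgint, mul_add]
  congr 1
  rw [integral_indicator Metric.isOpen_ball.measurableSet, pow_add, mul_comm (s ^ _), mul_assoc,
    pow_finrank_mul_setIntegral_ball (fun u : V => Real.exp (-(s ^ 2 * g u)) * ψ u) hs δ,
    ← integral_const_mul]
  have hodd : ∫ y in Metric.ball (0 : V) (s * δ), s * (Real.exp (-Q y) * ℓ y) = 0 :=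
    setIntegral_ball_eq_zero_of_odd (fun y => by rw [h.Q_neg, map_neg]; ring) _
  have hcomp : ∀ F : V → ℝ, Continuous F → IntegrableOn F (Metric.ball (0 : V) (s * δ)) :=
    fun F hF => (hF.continuousOn.integrableOn_compact
      (isCompact_closedBall (0 : V) (s * δ))).mono_set Metric.ball_subset_closedBall
  rw [← add_zero (∫ y in Metric.ball (0 : V) (s * δ), G s y), ← hodd,
    ← integral_add (hcomp _ (hGc s)) (hcomp _ (by fun_prop))]
  congr 1 with y
  simp only [hG, map_smul, smul_eq_mul]
  field_simp
  ring

end IsLaplaceModel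

end

/-! ### Gaussian integrals -/

section

variable {V : Type*} [NormedAddCommGroup V] [InnerProductSpace ℝ V] [FiniteDimensional ℝ V]
  [MeasurableSpace V] [BorelSpace V]

lemma integral_comp_linearMap {L : V →ₗ[ℝ] V} (hL : LinearMap.det L ≠ 0) {F : V → ℝ}
    (hF : Continuous F) : ∫ y, F (L y) = |LinearMap.det L|⁻¹ * ∫ y, F y := by
  have hLc : Continuous L := L.continuous_of_finiteDimensional
  have h1 := integral_map (μ := (volume : Measure V)) (φ := L) hLc.aemeasurable
    (f := F) hF.aestronglyMeasurable
  rw [← h1, Measure.map_linearMap_addHaar_eq_smul_addHaar _ hL, integral_smul_measure,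
    ENNReal.toReal_ofReal (abs_nonneg _), abs_inv, smul_eq_mul]

/-- Integration by parts against `exp (-Q)`. -/
lemma integral_exp_neg_mul_fderiv {Q w : V → ℝ} (hQ : Differentiable ℝ Q)
    (hw : Differentiable ℝ w) (v : V)
    (h1 : Integrable fun y => Real.exp (-Q y) * (fderiv ℝ Q y v * w y))
    (h2 : Integrable fun y => Real.exp (-Q y) * fderiv ℝ w y v)
    (h3 : Integrable fun y => Real.exp (-Q y) * w y) :
    ∫ y, Real.exp (-Q y) * (fderiv ℝ Q y v * w y) = ∫ y, Real.exp (-Q y) * fderiv ℝ w y v := by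
  have hd : ∀ y, fderiv ℝ (fun y => Real.exp (-Q y)) y v
      = -(Real.exp (-Q y) * fderiv ℝ Q y v) := by
    intro y
    have h : HasFDerivAt (fun y => Real.exp (-Q y)) _ y := (hQ y).hasFDerivAt.neg.exp
    rw [h.fderiv]
    simp
  have := integral_mul_fderiv_eq_neg_fderiv_mul_of_integrable (μ := (volume : Measure V))
    (f := fun y => Real.exp (-Q y)) (g := w) (v := v)
    (by simp only [hd]; refine h1.neg.congr (ae_of_all _ fun y => ?_); simp; ring)
    h2 h3 (fun y _ => (hQ y).neg.exp) (fun y _ => hw y)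
  rw [this, ← integral_neg]
  congr 1 with y
  rw [hd]; ring

variable {d : ℕ}

/-- The quadratic form `½ ⟨y, H y⟩`. -/
def halfQuad (H : Matrix (Fin d) (Fin d) ℝ) (y : E d) : ℝ := (1 / 2) * (y.ofLp ⬝ᵥ H *ᵥ y.ofLp)

lemma halfQuad_eq_inner (H : Matrix (Fin d) (Fin d) ℝ) (y : E d) :
    halfQuad H y = (1 / 2) * inner ℝ y (Matrix.toEuclideanCLM (n := Fin d) (𝕜 := ℝ) H y) := by
  rw [halfQuad, EuclideanSpace.inner_eq_star_dotProduct, dotProduct_comm]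
  simp

lemma differentiable_halfQuad (H : Matrix (Fin d) (Fin d) ℝ) :
    Differentiable ℝ (halfQuad H : E d → ℝ) := by
  rw [funext (halfQuad_eq_inner H)]
  have : Differentiable ℝ fun y : E d => inner ℝ y (Matrix.toEuclideanCLM (n := Fin d) (𝕜 := ℝ) H y) :=
    differentiable_id.inner ℝ (ContinuousLinearMap.differentiable _)
  exact this.const_mul _

lemma fderiv_halfQuad {H : Matrix (Fin d) (Fin d) ℝ} (hH : H.IsSymm) (y v : E d) :
    fderiv ℝ (halfQuad H : E d → ℝ) y v = v.ofLp ⬝ᵥ H *ᵥ y.ofLp := by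
  have h1 := ((hasFDerivAt_id (𝕜 := ℝ) y).inner ℝ
    (Matrix.toEuclideanCLM (n := Fin d) (𝕜 := ℝ) H).hasFDerivAt).const_mul (1 / 2 : ℝ)
  have h2 : (fun y : E d => (1 / 2 : ℝ) * inner ℝ (id y)
    (Matrix.toEuclideanCLM (n := Fin d) (𝕜 := ℝ) H y)) = halfQuad H := by
    ext y; rw [halfQuad_eq_inner]; rfl
  rw [h2] at h1
  rw [h1.fderiv]
  simp only [_root_.smul_apply, ContinuousLinearMap.comp_apply,
    ContinuousLinearMap.prod_apply, fderivInnerCLM_apply, id, ContinuousLinearMap.id_apply,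
    EuclideanSpace.inner_eq_star_dotProduct, smul_eq_mul]
  simp only [star_trivial, Matrix.ofLp_toEuclideanCLM]
  have e : (H *ᵥ v.ofLp) ⬝ᵥ y.ofLp = (H *ᵥ y.ofLp) ⬝ᵥ v.ofLp := by
    rw [dotProduct_comm, dotProduct_mulVec, ← mulVec_transpose, hH.eq]
  rw [e, dotProduct_comm v.ofLp]
  ring

lemma integral_exp_neg_halfQuad {H : Matrix (Fin d) (Fin d) ℝ} (hH : H.PosDef) :
    ∫ y : E d, Real.exp (-halfQuad H y) = (2 * Real.pi) ^ ((d : ℝ) / 2) / Real.sqrt H.det := by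
  obtain ⟨S, hS⟩ : ∃ S : Matrix (Fin d) (Fin d) ℝ, H = Sᵀ * S := by
    open MatrixOrder in
    obtain ⟨S, hS⟩ := CStarAlgebra.nonneg_iff_eq_star_mul_self.mp hH.posSemidef.nonneg
    exact ⟨S, by rw [hS, star_eq_conjTranspose, conjTranspose_eq_transpose_of_trivial]⟩
  have hdet : H.det = S.det ^ 2 := by rw [hS, det_mul, det_transpose, sq]
  have hS0 : S.det ≠ 0 := fun h0 => by
    have := hH.det_pos; rw [hdet, h0] at this; simp at this
  have hL : LinearMap.det (Matrix.toLpLin 2 2 S) ≠ 0 := by rwa [LinearMap.det_toLpLin]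
  have h1 := integral_comp_linearMap (V := E d) hL
    (F := fun y => Real.exp (-(1 / 2) * ‖y‖ ^ 2)) (by fun_prop)
  rw [GaussianFourier.integral_rexp_neg_mul_sq_norm (by norm_num), LinearMap.det_toLpLin,
    finrank_euclideanSpace, Fintype.card_fin] at h1
  have h2 : ∀ y : E d, halfQuad H y = (1 / 2) * ‖Matrix.toLpLin 2 2 S y‖ ^ 2 := by
    intro y
    rw [halfQuad, EuclideanSpace.real_norm_sq_eq, hS, ← mulVec_mulVec, dotProduct_mulVec,
      vecMul_transpose]
    simp only [dotProduct, Matrix.toLpLin_apply, sq]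
  simp only [h2]
  rw [hdet, Real.sqrt_sq_eq_abs]
  simp only [neg_mul] at h1
  rw [h1]
  rw [show Real.pi / (1 / 2) = 2 * Real.pi by ring]
  ring

lemma sum_smul_bvec (a : E d) : ∑ i, a.ofLp i • bvec d i = a := by
  have := (EuclideanSpace.basisFun (Fin d) ℝ).sum_repr a
  simpa [bvec] using this

lemma map_cons_eq_sum {n : ℕ} (T : ContinuousMultilinearMap ℝ (fun _ : Fin (n + 1) => E d) ℝ)
    (a : E d) (m : Fin n → E d) :
    T (Fin.cons a m) = ∑ i, a.ofLp i * T (Fin.cons (bvec d i) m) := by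
  have h1 : ∀ a, T (Fin.cons a m) = T.curryLeft a m := fun a => rfl
  simp only [h1]
  conv_lhs => rw [← sum_smul_bvec a]
  rw [map_sum, _root_.sum_apply]
  simp

lemma map_pair_eq_sum (T : ContinuousMultilinearMap ℝ (fun _ : Fin 2 => E d) ℝ) (a b : E d) :
    T ![a, b] = ∑ i, ∑ j, a.ofLp i * b.ofLp j * T ![bvec d i, bvec d j] := by
  rw [show T ![a, b] = T (Fin.cons a ![b]) from rfl, map_cons_eq_sum]
  refine Finset.sum_congr rfl fun i _ => ?_
  rw [show T (Fin.cons (bvec d i) ![b]) = T.curryLeft (bvec d i) (Fin.cons b ![]) from rfl,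
    map_cons_eq_sum, Finset.mul_sum]
  refine Finset.sum_congr rfl fun j _ => ?_
  rw [mul_assoc]
  rfl

lemma abs_ofLp_le (y : E d) (k : Fin d) : |y.ofLp k| ≤ ‖y‖ := PiLp.norm_apply_le y k

lemma abs_dotProduct_mulVec_le (H : Matrix (Fin d) (Fin d) ℝ) (v : E d) :
    ∃ C : ℝ, ∀ y : E d, |v.ofLp ⬝ᵥ H *ᵥ y.ofLp| ≤ C * ‖y‖ := by
  refine ⟨‖v‖ * ‖Matrix.toEuclideanCLM (n := Fin d) (𝕜 := ℝ) H‖, fun y => ?_⟩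
  have h1 : v.ofLp ⬝ᵥ H *ᵥ y.ofLp = inner ℝ v (Matrix.toEuclideanCLM (n := Fin d) (𝕜 := ℝ) H y) := by
    rw [EuclideanSpace.inner_eq_star_dotProduct, dotProduct_comm]; simp
  rw [h1, mul_assoc]
  exact (abs_real_inner_le_norm _ _).trans (by gcongr; exact ContinuousLinearMap.le_opNorm _ _)

namespace IsLaplaceModel

variable {g c : E d → ℝ} {κ δ η M : ℝ} {H : Matrix (Fin d) (Fin d) ℝ}

lemma gaussian_by_parts (h : IsLaplaceModel g (halfQuad H) c κ δ η M) (hH : H.PosDef)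
    {w : E d → ℝ} (hw : ContDiff ℝ 1 w) (v : E d) {C C' : ℝ} {k k' : ℕ}
    (hC : ∀ y, |w y| ≤ C * ‖y‖ ^ k) (hC' : ∀ y, |fderiv ℝ w y v| ≤ C' * ‖y‖ ^ k') :
    ∫ y, Real.exp (-halfQuad H y) * ((v.ofLp ⬝ᵥ H *ᵥ y.ofLp) * w y)
      = ∫ y, Real.exp (-halfQuad H y) * fderiv ℝ w y v := by
  have hs : H.IsSymm := by
    have := hH.isHermitian
    rwa [Matrix.IsHermitian, conjTranspose_eq_transpose_of_trivial] at this
  have hf := fun y => fderiv_halfQuad hs y v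
  obtain ⟨D, hD⟩ := abs_dotProduct_mulVec_le H v
  have hcont : Continuous fun y : E d => v.ofLp ⬝ᵥ H *ᵥ y.ofLp := by fun_prop
  have := integral_exp_neg_mul_fderiv (differentiable_halfQuad H)
    (hw.differentiable one_ne_zero) v (by
      simp only [hf]
      refine h.integrable_exp_neg_Q_mul (hcont.mul hw.continuous) (C := D * C) (k := k + 1)
        fun y => ?_
      rw [abs_mul]
      calc _ ≤ (D * ‖y‖) * (C * ‖y‖ ^ k) := by
            refine mul_le_mul (hD y) (hC y) (abs_nonneg _) ((abs_nonneg _).trans (hD y))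
        _ = _ := by ring)
    (h.integrable_exp_neg_Q_mul ((hw.continuous_fderiv one_ne_zero).clm_apply continuous_const) hC')
    (h.integrable_exp_neg_Q_mul hw.continuous hC)
  simpa only [hf] using this

lemma gaussian_second_moment (h : IsLaplaceModel g (halfQuad H) c κ δ η M) (hH : H.PosDef)
    (k l : Fin d) : ∫ y : E d, Real.exp (-halfQuad H y) * (y.ofLp k * y.ofLp l)
      = H⁻¹ k l * ∫ y, Real.exp (-halfQuad H y) := by
  have hs : H⁻¹.IsSymm := by
    have := hH.inv.isHermitian
    rwa [Matrix.IsHermitian, conjTranspose_eq_transpose_of_trivial] at this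
  set v : E d := WithLp.toLp 2 (H⁻¹ *ᵥ Pi.single k 1) with hv
  have hvH : ∀ y : E d, v.ofLp ⬝ᵥ H *ᵥ y.ofLp = y.ofLp k := by
    intro y
    rw [hv]
    simp only
    rw [← vecMul_transpose, hs.eq, dotProduct_mulVec, vecMul_vecMul,
      Matrix.nonsing_inv_mul _ (hH.det_pos.ne'.isUnit), vecMul_one, single_one_dotProduct]
  have hd : ∀ y, fderiv ℝ (fun y : E d => y.ofLp l) y v = H⁻¹ k l := by
    intro y
    have : (fun y : E d => y.ofLp l) = EuclideanSpace.proj (𝕜 := ℝ) l := rfl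
    rw [this, ContinuousLinearMap.fderiv]
    simp [hv, ← hs.apply k l]
  have := h.gaussian_by_parts hH (w := fun y : E d => y.ofLp l) (by fun_prop) v
    (C := 1) (k := 1) (C' := |H⁻¹ k l|) (k' := 0)
    (fun y => by simpa using abs_ofLp_le y l) (fun y => by simp [hd])
  simp only [hvH, hd] at this
  rw [this, integral_mul_const, mul_comm]

lemma gaussian_bilinear (h : IsLaplaceModel g (halfQuad H) c κ δ η M) (hH : H.PosDef)
    (T : ContinuousMultilinearMap ℝ (fun _ : Fin 2 => E d) ℝ) :
    ∫ y : E d, Real.exp (-halfQuad H y) * T ![y, y]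
      = (∑ k, ∑ l, H⁻¹ k l * T ![bvec d k, bvec d l]) * ∫ y, Real.exp (-halfQuad H y) := by
  have hi : ∀ k l, Integrable fun y : E d => Real.exp (-halfQuad H y) * (y.ofLp k * y.ofLp l) :=
    fun k l => h.integrable_exp_neg_Q_mul (by fun_prop) (C := 1) (k := 2) fun y => by
      rw [abs_mul, one_mul, sq]
      exact mul_le_mul (abs_ofLp_le _ _) (abs_ofLp_le _ _) (abs_nonneg _) (norm_nonneg _)
  have e : ∀ y : E d, Real.exp (-halfQuad H y) * T ![y, y]
      = ∑ k, ∑ l, (Real.exp (-halfQuad H y) * (y.ofLp k * y.ofLp l))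
        * T ![bvec d k, bvec d l] := by
    intro y
    rw [map_pair_eq_sum, Finset.mul_sum]
    simp only [Finset.mul_sum, mul_assoc]
  simp only [e]
  rw [integral_finsetSum _ fun k _ => integrable_finsetSum _ fun l _ => (hi k l).mul_const _,
    Finset.sum_mul]
  refine Finset.sum_congr rfl fun k _ => ?_
  rw [integral_finsetSum _ fun l _ => (hi k l).mul_const _, Finset.sum_mul]
  refine Finset.sum_congr rfl fun l _ => ?_
  rw [integral_mul_const, h.gaussian_second_moment hH]
  ring

end IsLaplaceModel

end

/-! ### Taylor expansion at the minimizer -/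

section

open scoped Nat
section Taylor
variable {V : Type*} [NormedAddCommGroup V] [NormedSpace ℝ V]

lemma iteratedFDeriv_two_swap {f : V → ℝ} (hf : ContDiff ℝ 2 f) (x a b : V) :
    iteratedFDeriv ℝ 2 f x ![a, b] = iteratedFDeriv ℝ 2 f x ![b, a] :=
  IsSymmSndFDerivAt.iteratedFDeriv_cons (hf := hf.contDiffAt.isSymmSndFDerivAt (by simp))

lemma iteratedFDeriv_three_swap_right {f : V → ℝ} (hf : ContDiff ℝ 3 f) (x a b c : V) :
    iteratedFDeriv ℝ 3 f x ![a, b, c] = iteratedFDeriv ℝ 3 f x ![a, c, b] := by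
  have hd : DifferentiableAt ℝ (iteratedFDeriv ℝ 2 f) x :=
    hf.contDiffAt.differentiableAt_iteratedFDeriv (by norm_num)
  have h1 := fun m : Fin 3 → V => hd.iteratedFDeriv_succ_apply_left' (m := m)
  have h2 : ∀ a b c : V, Fin.tail ![a, b, c] = ![b, c] := fun a b c => rfl
  rw [h1, h1, h2, h2]
  simp only [iteratedFDeriv_two_swap (hf.of_le (by norm_num)) _ b c]
  rfl

lemma iteratedFDeriv_three_swap_left {f : V → ℝ} (hf : ContDiff ℝ 3 f) (x a b c : V) :
    iteratedFDeriv ℝ 3 f x ![a, b, c] = iteratedFDeriv ℝ 3 f x ![b, a, c] := by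
  have hd : ContDiff ℝ 2 (fderiv ℝ f) := hf.fderiv_right (by norm_num)
  have hs : IsSymmSndFDerivAt ℝ (fderiv ℝ f) x := hd.contDiffAt.isSymmSndFDerivAt (by simp)
  have h1 := fun m : Fin 3 → V => iteratedFDeriv_succ_apply_right (𝕜 := ℝ) (f := f) (x := x) m
  have h2 : ∀ a b c : V, Fin.init ![a, b, c] = ![a, b] := fun a b c => by
    ext i; fin_cases i <;> rfl
  rw [h1, h1, h2, h2, IsSymmSndFDerivAt.iteratedFDeriv_cons (hf := hs)]
  rfl

lemma abs_diag_le {n : ℕ} (T : ContinuousMultilinearMap ℝ (fun _ : Fin n => V) ℝ) (y : V) :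
    |T fun _ => y| ≤ ‖T‖ * ‖y‖ ^ n := by
  simpa using T.le_opNorm fun _ => y

lemma diag_smul {n : ℕ} (T : ContinuousMultilinearMap ℝ (fun _ : Fin n => V) ℝ) (t : ℝ) (y : V) :
    (T fun _ => t • y) = t ^ n * T fun _ => y := by
  simpa using T.map_smul_univ (fun _ => t) fun _ => y

lemma taylor_remainder_le [FiniteDimensional ℝ V] {f : V → ℝ} {n : ℕ} (hf : ContDiff ℝ (n + 1) f)
    (x : V) : ∃ M : ℝ, 0 ≤ M ∧ ∀ u : V, ‖u‖ ≤ 1 →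
      |f (x + u) - ∑ k ∈ Finset.range (n + 1), (k ! : ℝ)⁻¹ * iteratedFDeriv ℝ k f x fun _ => u|
        ≤ M * ‖u‖ ^ (n + 1) := by
  have hcont : Continuous (iteratedFDeriv ℝ (n + 1) f) :=
    hf.continuous_iteratedFDeriv (by norm_cast)
  have hproper : ProperSpace V := FiniteDimensional.proper ℝ V
  obtain ⟨C, hC⟩ := (isCompact_closedBall x 1).exists_bound_of_continuousOn hcont.continuousOn
  have hC0 : 0 ≤ C := (norm_nonneg _).trans (hC x (by simp))
  refine ⟨(n ! : ℝ)⁻¹ * C, by positivity, fun u hu => ?_⟩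
  rw [map_add_eq_sum_add_integral_iteratedFDeriv (n := n) (fun t _ => hf.contDiffAt)]
  simp only [smul_eq_mul, add_sub_cancel_left]
  rw [abs_mul, abs_of_nonneg (by positivity : 0 ≤ (n ! : ℝ)⁻¹), mul_assoc]
  gcongr
  have := intervalIntegral.norm_integral_le_of_norm_le_const (a := 0) (b := 1)
    (C := C * ‖u‖ ^ (n + 1))
    (f := fun t => (1 - t) ^ n * iteratedFDeriv ℝ (n + 1) f (x + t • u) fun _ => u) ?_
  · simpa using this
  intro t ht
  rw [Set.uIoc_of_le zero_le_one] at ht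
  have h1 : |1 - t| ≤ 1 := by rw [abs_le]; constructor <;> linarith [ht.1, ht.2]
  have h2 : ‖iteratedFDeriv ℝ (n + 1) f (x + t • u)‖ ≤ C := by
    apply hC
    rw [Metric.mem_closedBall, dist_eq_norm, add_sub_cancel_left, norm_smul,
      Real.norm_of_nonneg ht.1.le]
    exact mul_le_one₀ ht.2 (norm_nonneg _) hu
  rw [norm_mul, norm_pow, Real.norm_eq_abs]
  calc _ ≤ 1 * (C * ‖u‖ ^ (n + 1)) := by
        gcongr
        · exact pow_le_one₀ (abs_nonneg _) h1
        · exact (abs_diag_le _ _).trans (by gcongr)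
    _ = _ := one_mul _

lemma tendsto_second_difference {f : V → ℝ} (hf : ContDiff ℝ 2 f) (x y : V) :
    Tendsto (fun s : ℝ => s ^ 2 * (f (x + s⁻¹ • y) - f x - fderiv ℝ f x (s⁻¹ • y))) atTop
      (𝓝 (1 / 2 * iteratedFDeriv ℝ 2 f x ![y, y])) := by
  have hcont : Continuous (iteratedFDeriv ℝ 2 f) := hf.continuous_iteratedFDeriv le_rfl
  set R : ℝ → ℝ := fun ε => ∫ t in (0 : ℝ)..1,
    (1 - t) * iteratedFDeriv ℝ 2 f (x + (t * ε) • y) fun _ => y with hR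
  have hRc : Continuous R := by
    apply intervalIntegral.continuous_parametric_intervalIntegral_of_continuous'
    have : Continuous fun p : ℝ × ℝ => iteratedFDeriv ℝ 2 f (x + (p.2 * p.1) • y) := by fun_prop
    have h2 : Continuous fun p : ℝ × ℝ => iteratedFDeriv ℝ 2 f (x + (p.2 * p.1) • y) fun _ => y :=
      this.eval_const _
    exact (by fun_prop : Continuous fun p : ℝ × ℝ => 1 - p.2).mul h2
  have hR0 : R 0 = 1 / 2 * iteratedFDeriv ℝ 2 f x ![y, y] := by
    simp only [hR, mul_zero, zero_smul, add_zero]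
    rw [intervalIntegral.integral_mul_const]
    have e : (fun _ : Fin 2 => y) = ![y, y] := by ext i; fin_cases i <;> rfl
    rw [e]
    congr 1
    rw [intervalIntegral.integral_sub (by simp) (by simp), integral_id]
    norm_num
  have hlim : Tendsto (fun s : ℝ => R s⁻¹) atTop (𝓝 (1 / 2 * iteratedFDeriv ℝ 2 f x ![y, y])) := by
    rw [← hR0]
    exact (hRc.tendsto 0).comp tendsto_inv_atTop_zero
  refine hlim.congr' ?_
  filter_upwards [eventually_gt_atTop 0] with s hs
  have := map_add_eq_sum_add_integral_iteratedFDeriv (n := 1) (f := f) (x := x) (y := s⁻¹ • y)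
    (fun t _ => hf.contDiffAt)
  simp only [diag_smul, smul_smul] at this
  rw [this, Finset.sum_range_succ, Finset.sum_range_one]
  simp only [hR, smul_eq_mul, Nat.factorial, iteratedFDeriv_zero_apply, iteratedFDeriv_one_apply,
    map_smul]
  have e : ∀ t : ℝ, (1 - t) ^ 1 * (s⁻¹ ^ (1 + 1) *
      iteratedFDeriv ℝ (1 + 1) f (x + (t * s⁻¹) • y) fun _ => y)
      = s⁻¹ ^ 2 * ((1 - t) * iteratedFDeriv ℝ 2 f (x + (t * s⁻¹) • y) fun _ => y) :=
    fun t => by norm_num; ring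
  simp only [e, intervalIntegral.integral_const_mul]
  norm_num
  field_simp
  ring

end Taylor

variable {d : ℕ} {f : E d → ℝ} {xs : E d}

lemma halfQuad_hess (f : E d → ℝ) (xs y : E d) :
    halfQuad (hess f xs) y = 1 / 2 * iteratedFDeriv ℝ 2 f xs ![y, y] := by
  rw [halfQuad, map_pair_eq_sum]
  congr 1
  simp only [dotProduct, mulVec, hess, Matrix.of_apply, Finset.mul_sum]
  refine Finset.sum_congr rfl fun i _ => Finset.sum_congr rfl fun j _ => ?_
  ring

/-- The cubic Taylor term of `f` at `x`. -/
def cubicTerm (f : E d → ℝ) (x y : E d) : ℝ := 1 / 6 * iteratedFDeriv ℝ 3 f x fun _ => y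

lemma hasFDerivAt_diag {n : ℕ} (T : ContinuousMultilinearMap ℝ (fun _ : Fin n => E d) ℝ)
    (y : E d) : HasFDerivAt (fun y => T fun _ => y)
      ((T.linearDeriv fun _ => y).comp (ContinuousLinearMap.pi fun _ => ContinuousLinearMap.id ℝ _))
      y :=
  (T.hasFDerivAt fun _ => y).comp y
    (ContinuousLinearMap.pi fun _ => ContinuousLinearMap.id ℝ (E d)).hasFDerivAt

lemma contDiff_cubicTerm (f : E d → ℝ) (x : E d) : ContDiff ℝ 1 (cubicTerm f x) := by
  unfold cubicTerm
  have h1 : ContDiff ℝ 1 fun y : E d => (fun _ : Fin 3 => y) := by fun_prop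
  exact contDiff_const.mul ((iteratedFDeriv ℝ 3 f x).contDiff.comp h1)

lemma fderiv_cubicTerm (hf : ContDiff ℝ 3 f) (x y v : E d) :
    fderiv ℝ (cubicTerm f x) y v = 1 / 2 * iteratedFDeriv ℝ 3 f x ![v, y, y] := by
  have h := (hasFDerivAt_diag (iteratedFDeriv ℝ 3 f x) y).const_mul (1 / 6 : ℝ)
  change HasFDerivAt (cubicTerm f x) _ y at h
  rw [h.fderiv]
  simp only [_root_.smul_apply, ContinuousLinearMap.comp_apply,
    ContinuousMultilinearMap.linearDeriv_apply, Fin.sum_univ_three, smul_eq_mul]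
  have e0 : Function.update (fun _ : Fin 3 => y) 0 v = ![v, y, y] := by
    ext i : 1; fin_cases i <;> rfl
  have e1 : Function.update (fun _ : Fin 3 => y) 1 v = ![y, v, y] := by
    ext i : 1; fin_cases i <;> rfl
  have e2 : Function.update (fun _ : Fin 3 => y) 2 v = ![y, y, v] := by
    ext i : 1; fin_cases i <;> rfl
  simp only [ContinuousLinearMap.coe_pi', ContinuousLinearMap.id_apply, e0, e1, e2]
  rw [iteratedFDeriv_three_swap_right hf x y y v, iteratedFDeriv_three_swap_left hf x y v y]
  ring

lemma exists_halfQuad_ge {H : Matrix (Fin d) (Fin d) ℝ} (hH : H.PosDef) :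
    ∃ κ : ℝ, 0 < κ ∧ ∀ y : E d, κ * ‖y‖ ^ 2 ≤ halfQuad H y := by
  have hc : Continuous (halfQuad H : E d → ℝ) := (differentiable_halfQuad H).continuous
  have hpos : ∀ y ∈ Metric.sphere (0 : E d) 1, 0 < halfQuad H y := by
    intro y hy
    have hy0 : y.ofLp ≠ 0 := by
      intro h0
      have : y = 0 := by ext i; rw [h0]; rfl
      rw [this] at hy; simp at hy
    have := hH.dotProduct_mulVec_pos hy0
    simp only [star_trivial] at this
    unfold halfQuad
    positivity
  obtain ⟨κ, hκ, h⟩ := (isCompact_sphere (0 : E d) 1).exists_forall_le' hc.continuousOn hpos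
  refine ⟨κ, hκ, fun y => ?_⟩
  by_cases hy : y = 0
  · simp [hy, halfQuad]
  have hn : 0 < ‖y‖ := norm_pos_iff.2 hy
  have h1 := h (‖y‖⁻¹ • y) (by simp [norm_smul, hn.ne'])
  have h2 : halfQuad H (‖y‖⁻¹ • y) = ‖y‖⁻¹ ^ 2 * halfQuad H y := by
    simp only [halfQuad, WithLp.ofLp_smul, mulVec_smul, dotProduct_smul, smul_dotProduct,
      smul_eq_mul]
    ring
  rw [h2, inv_pow, ← div_eq_inv_mul, le_div_iff₀ (by positivity)] at h1
  exact h1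

lemma IsObjective.exists_gap (hf : IsObjective f xs) {δ : ℝ} (hδ : 0 < δ) :
    ∃ η : ℝ, 0 < η ∧ ∀ u, δ ≤ ‖u‖ → η ≤ f (xs + u) - f xs := by
  obtain ⟨η₁, hη₁, R, hR⟩ := hf.separated
  have hfc := hf.contDiff.continuous
  set K := Metric.closedBall (0 : E d) (R + ‖xs‖) ∩ {u | δ ≤ ‖u‖}
  have hK : IsCompact K := (isCompact_closedBall _ _).inter_right
    (isClosed_le continuous_const continuous_norm)
  obtain ⟨η₂, hη₂, h⟩ := hK.exists_forall_le' (f := fun u => f (xs + u) - f xs) (a := 0)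
    (by fun_prop) (fun u hu => by
      have : u ≠ 0 := fun h0 => by
        have := hu.2; simp only [h0, Set.mem_ofPred_eq, norm_zero] at this; linarith
      have := hf.unique_min (xs + u) (by simpa using this)
      linarith)
  refine ⟨min η₁ η₂, lt_min hη₁ hη₂, fun u hu => ?_⟩
  rcases le_total ‖u‖ (R + ‖xs‖) with h1 | h1
  · exact (min_le_right _ _).trans (h u ⟨by simpa using h1, hu⟩)
  · have h2 : ‖u‖ ≤ ‖xs + u‖ + ‖xs‖ := by
      have := norm_sub_le (xs + u) xs
      simpa using this
    have := hR (xs + u) (by linarith)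
    exact (min_le_left _ _).trans (by linarith)

lemma IsObjective.fderiv_eq_zero (hf : IsObjective f xs) : fderiv ℝ f xs = 0 := by
  refine IsLocalMin.fderiv_eq_zero (Eventually.of_forall fun x => ?_)
  by_cases h : x = xs
  · rw [h]
  · exact (hf.unique_min x h).le

theorem IsObjective.exists_isLaplaceModel (hf : IsObjective f xs) :
    ∃ κ δ η M, IsLaplaceModel (fun u => f (xs + u) - f xs) (halfQuad (hess f xs))
      (cubicTerm f xs) κ δ η M := by
  have hfc := hf.contDiff.continuous
  obtain ⟨κ, hκ, hQ⟩ := exists_halfQuad_ge hf.posDef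
  obtain ⟨M₁, hM₁, hT⟩ := taylor_remainder_le (n := 3) (f := f) (by exact_mod_cast hf.contDiff) xs
  set M := M₁ + ‖iteratedFDeriv ℝ 3 f xs‖ with hM
  have hM0 : 0 ≤ M := by positivity
  have hc : ∀ u, |cubicTerm f xs u| ≤ M * ‖u‖ ^ 3 := by
    intro u
    rw [cubicTerm, abs_mul]
    have := abs_diag_le (iteratedFDeriv ℝ 3 f xs) u
    have h3 : 0 ≤ M₁ * ‖u‖ ^ 3 := by positivity
    have h4 : 0 ≤ |iteratedFDeriv ℝ 3 f xs fun _ => u| := abs_nonneg _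
    norm_num [abs_of_pos]
    rw [hM, add_mul]
    linarith
  have htay : ∀ u, ‖u‖ ≤ 1 →
      |f (xs + u) - f xs - halfQuad (hess f xs) u - cubicTerm f xs u| ≤ M * ‖u‖ ^ 4 := by
    intro u hu
    have h1 := hT u hu
    simp only [Finset.sum_range_succ, Finset.range_zero, Finset.sum_empty,
      iteratedFDeriv_zero_apply, iteratedFDeriv_one_apply, hf.fderiv_eq_zero] at h1
    have e : (fun _ : Fin 2 => u) = ![u, u] := by ext i : 1; fin_cases i <;> rfl
    rw [e] at h1
    have h2 : M₁ * ‖u‖ ^ 4 ≤ M * ‖u‖ ^ 4 := by gcongr; rw [hM]; linarith [norm_nonneg (iteratedFDeriv ℝ 3 f xs)]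
    refine le_trans (le_of_eq ?_) (h1.trans h2)
    rw [halfQuad_hess, cubicTerm]
    congr 1
    norm_num [Nat.factorial]
    ring
  set δ := min 1 (κ / (4 * (M + 1))) with hδ
  have hδ0 : 0 < δ := by positivity
  have hδ1 : δ ≤ 1 := min_le_left _ _
  have hδ2 : δ * (4 * (M + 1)) ≤ κ := by
    rw [← le_div_iff₀ (by positivity)]; exact min_le_right _ _
  obtain ⟨η, hη, hgap⟩ := hf.exists_gap hδ0
  refine ⟨κ / 2, δ, η, M, ?_⟩
  constructor
  · fun_prop
  · exact (differentiable_halfQuad _).continuous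
  · exact (contDiff_cubicTerm f xs).continuous
  · intro t u
    simp only [halfQuad, WithLp.ofLp_smul, mulVec_smul, dotProduct_smul, smul_dotProduct,
      smul_eq_mul]
    ring
  · intro t u
    rw [cubicTerm, diag_smul, cubicTerm]
    ring
  · positivity
  · exact hδ0
  · exact hδ1
  · exact hη
  · exact hM0
  · intro u
    have := hQ u
    have : 0 ≤ κ * ‖u‖ ^ 2 := by positivity
    linarith
  · intro u hu
    have h1 := (abs_le.1 (htay u (by linarith))).1
    have h2 := (abs_le.1 (hc u)).1
    have h3 := hQ u
    have hu0 := norm_nonneg u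
    have h4 : M * ‖u‖ ^ 4 ≤ M * ‖u‖ ^ 3 := by
      gcongr 1
      exact pow_le_pow_of_le_one hu0 (by linarith) (by norm_num)
    have h5 : 4 * (M + 1) * ‖u‖ ≤ κ := by nlinarith
    have h6 : 2 * M * ‖u‖ ^ 3 ≤ κ / 2 * ‖u‖ ^ 2 := by
      have : 4 * M * ‖u‖ ≤ κ := by nlinarith
      nlinarith [mul_le_mul_of_nonneg_right this (sq_nonneg ‖u‖)]
    linarith
  · exact hgap
  · exact hc
  · intro u hu
    exact htay u (by linarith)
  · have h1 : Integrable fun u => Real.exp (-f (xs + u)) := hf.integrable.comp_add_left xs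
    refine (h1.const_mul (Real.exp (f xs))).congr (ae_of_all _ fun u => ?_)
    simp only
    rw [← Real.exp_add]
    ring_nf

end

/-! ### The first-order coefficient -/

section

variable {d : ℕ} {f : E d → ℝ} {xs : E d}

lemma fderiv_eq_grad_dotProduct (ψ : E d → ℝ) (x y : E d) :
    fderiv ℝ ψ x y = grad ψ x ⬝ᵥ y.ofLp := by
  conv_lhs => rw [← sum_smul_bvec y]
  simp only [map_sum, map_smul, smul_eq_mul, dotProduct, grad]
  exact Finset.sum_congr rfl fun i _ => mul_comm _ _

/-- The signed quantity whose absolute value is `lapC`. -/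
def signedLapC (f : E d → ℝ) (x : E d) (ψ : E d → ℝ) : ℝ :=
  ((hess f x)⁻¹ * hess ψ x).trace - ((hess f x)⁻¹.mulVec (grad ψ x)) ⬝ᵥ ptr3 f x

lemma IsObjective.integral_model_term (hf : IsObjective f xs) {ψ : E d → ℝ}
    (hψ : ContDiff ℝ 2 ψ) :
    ∫ y : E d, Real.exp (-halfQuad (hess f xs) y) *
        (1 / 2 * iteratedFDeriv ℝ 2 ψ xs ![y, y] - cubicTerm f xs y * fderiv ℝ ψ xs y)
      = 1 / 2 * signedLapC f xs ψ * ∫ y : E d, Real.exp (-halfQuad (hess f xs) y) := by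
  obtain ⟨κ, δ, η, M, h⟩ := hf.exists_isLaplaceModel
  have hf3 : ContDiff ℝ 3 f := hf.contDiff.of_le (by norm_num)
  set H := hess f xs with hHdef
  have hH : H.PosDef := hf.posDef
  have hs : H⁻¹.IsSymm := by
    have := hH.inv.isHermitian
    rwa [Matrix.IsHermitian, conjTranspose_eq_transpose_of_trivial] at this
  set v : E d := WithLp.toLp 2 (H⁻¹ *ᵥ grad ψ xs) with hv
  have hvH : ∀ y : E d, v.ofLp ⬝ᵥ H *ᵥ y.ofLp = fderiv ℝ ψ xs y := by
    intro y
    rw [hv, fderiv_eq_grad_dotProduct]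
    simp only
    rw [← vecMul_transpose, hs.eq, dotProduct_mulVec, vecMul_vecMul,
      Matrix.nonsing_inv_mul _ (hH.det_pos.ne'.isUnit), vecMul_one]
  have ediag : ∀ y : E d, (fun _ : Fin 2 => y) = ![y, y] := fun y => by
    ext i : 1; fin_cases i <;> rfl
  set T : ContinuousMultilinearMap ℝ (fun _ : Fin 2 => E d) ℝ :=
    (iteratedFDeriv ℝ 3 f xs).curryLeft v with hT
  have hTv : ∀ a b, iteratedFDeriv ℝ 3 f xs ![v, a, b] = T ![a, b] := fun a b => rfl
  have hpc : ∀ S : ContinuousMultilinearMap ℝ (fun _ : Fin 2 => E d) ℝ,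
      Continuous fun y => S ![y, y] := fun S => by
    simp only [← ediag]; exact S.cont.comp (by fun_prop)
  have hpb : ∀ (S : ContinuousMultilinearMap ℝ (fun _ : Fin 2 => E d) ℝ) y,
      |S ![y, y]| ≤ ‖S‖ * ‖y‖ ^ 2 := fun S y => by
    simpa only [ediag] using abs_diag_le S y
  have hparts := h.gaussian_by_parts hH (contDiff_cubicTerm f xs) v h.c_le
    (C' := 1 / 2 * ‖T‖) (k' := 2) (fun y => by
      rw [fderiv_cubicTerm hf3, hTv, abs_mul, abs_of_pos (by norm_num : (0 : ℝ) < 1 / 2), mul_assoc]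
      gcongr
      exact hpb T y)
  simp only [hvH, fderiv_cubicTerm hf3, hTv] at hparts
  have hi1 : Integrable fun y => Real.exp (-halfQuad H y) *
      (1 / 2 * iteratedFDeriv ℝ 2 ψ xs ![y, y]) :=
    ((h.integrable_exp_neg_Q_mul (hpc _) (hpb _)).const_mul (1 / 2)).congr
      (ae_of_all _ fun y => by ring)
  have hi2 : Integrable fun y => Real.exp (-halfQuad H y) *
      (fderiv ℝ ψ xs y * cubicTerm f xs y) := by
    refine h.integrable_exp_neg_Q_mul
      ((fderiv ℝ ψ xs).continuous.mul (contDiff_cubicTerm f xs).continuous)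
      (C := ‖fderiv ℝ ψ xs‖ * M) (k := 4) fun y => ?_
    rw [abs_mul]
    calc _ ≤ (‖fderiv ℝ ψ xs‖ * ‖y‖) * (M * ‖y‖ ^ 3) :=
          mul_le_mul ((fderiv ℝ ψ xs).le_opNorm y) (h.c_le y) (abs_nonneg _) (by positivity)
      _ = _ := by ring
  have e : ∀ y : E d, Real.exp (-halfQuad H y) *
        (1 / 2 * iteratedFDeriv ℝ 2 ψ xs ![y, y] - cubicTerm f xs y * fderiv ℝ ψ xs y)
      = Real.exp (-halfQuad H y) * (1 / 2 * iteratedFDeriv ℝ 2 ψ xs ![y, y])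
        - Real.exp (-halfQuad H y) * (fderiv ℝ ψ xs y * cubicTerm f xs y) := fun y => by ring
  simp only [e]
  rw [integral_sub hi1 hi2, hparts]
  have e2 : ∀ S : ContinuousMultilinearMap ℝ (fun _ : Fin 2 => E d) ℝ,
      ∫ y, Real.exp (-halfQuad H y) * (1 / 2 * S ![y, y])
        = 1 / 2 * ((∑ k, ∑ l, H⁻¹ k l * S ![bvec d k, bvec d l])
          * ∫ y, Real.exp (-halfQuad H y)) := fun S => by
    rw [← h.gaussian_bilinear hH, ← integral_const_mul]
    congr 1 with y
    ring
  rw [e2, e2, signedLapC, ← hHdef]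
  have e3 : (H⁻¹ * hess ψ xs).trace
      = ∑ k, ∑ l, H⁻¹ k l * iteratedFDeriv ℝ 2 ψ xs ![bvec d k, bvec d l] := by
    simp only [trace, diag_apply, mul_apply, hess, of_apply]
    refine Finset.sum_congr rfl fun k _ => Finset.sum_congr rfl fun l _ => ?_
    rw [iteratedFDeriv_two_swap hψ]
  have e4 : (H⁻¹ *ᵥ grad ψ xs) ⬝ᵥ ptr3 f xs
      = ∑ k, ∑ l, H⁻¹ k l * T ![bvec d k, bvec d l] := by
    have hTs : ∀ k l, T ![bvec d k, bvec d l]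
        = ∑ i, v.ofLp i * iteratedFDeriv ℝ 3 f xs ![bvec d i, bvec d k, bvec d l] :=
      fun k l => map_cons_eq_sum (iteratedFDeriv ℝ 3 f xs) v ![bvec d k, bvec d l]
    simp only [hTs, Finset.mul_sum, dotProduct, ptr3, ← hHdef]
    rw [Finset.sum_comm]
    have : ∀ k : Fin d, ∑ l, ∑ i, H⁻¹ k l *
        (v.ofLp i * iteratedFDeriv ℝ 3 f xs ![bvec d i, bvec d k, bvec d l])
      = ∑ i, ∑ l, H⁻¹ k l *
        (v.ofLp i * iteratedFDeriv ℝ 3 f xs ![bvec d i, bvec d k, bvec d l]) :=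
      fun k => Finset.sum_comm
    simp only [this]
    refine Finset.sum_congr rfl fun k _ => Finset.sum_congr rfl fun i _ =>
      Finset.sum_congr rfl fun l _ => ?_
    simp only [hv]
    ring
  rw [e3, e4]
  ring

theorem IsObjective.tendsto_laplace (hf : IsObjective f xs) {ψ : E d → ℝ}
    (hψ : ContDiff ℝ 2 ψ) {m : ℝ}
    (hint : Integrable fun u => Real.exp (-(m * (f (xs + u) - f xs))) * (ψ (xs + u) - ψ xs)) :
    Tendsto (fun s : ℝ => s ^ (d + 2) *
        ∫ u, Real.exp (-(s ^ 2 * (f (xs + u) - f xs))) * (ψ (xs + u) - ψ xs)) atTop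
      (𝓝 (1 / 2 * signedLapC f xs ψ * ∫ y : E d, Real.exp (-halfQuad (hess f xs) y))) := by
  obtain ⟨κ, δ, η, M, h⟩ := hf.exists_isLaplaceModel
  obtain ⟨M', _, hM'⟩ := taylor_remainder_le (n := 1) (f := ψ) (by exact_mod_cast hψ) xs
  have hψc := hψ.continuous
  have := h.tendsto_integral_of_vanishing (ψ := fun u => ψ (xs + u) - ψ xs)
    (p := fun y => 1 / 2 * iteratedFDeriv ℝ 2 ψ xs ![y, y]) (fderiv ℝ ψ xs) (M' := M') (m := m)
    (by fun_prop) (fun u hu => by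
      have := hM' u (by linarith [h.δ_le])
      simpa [Finset.sum_range_succ, sub_sub] using this)
    (fun y => tendsto_second_difference hψ xs y) hint
  rw [hf.integral_model_term hψ, finrank_euclideanSpace, Fintype.card_fin] at this
  exact this

lemma second_moment_ratio_le {n : ℕ} {a r α K Z I₁ I₂ J c C : ℝ} (ha : 0 < a) (hr : 0 < r)
    (hα : 0 < α) (hZ : 0 < Z) (hK : 0 ≤ K) (hc : 0 ≤ c) (hC : 0 ≤ C)
    (h₁ : |a ^ n * I₁ - Z| ≤ K / α) (h₂ : |(r * a) ^ n * I₂ - Z| ≤ K / (2 * α))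
    (hJ : (r * a) ^ n * (2 * α) * J ≤ C * Z) (hKα : 4 * (K / Z) ≤ α) :
    (c * I₂ + J) / I₁ ^ 2 ≤
      a ^ n / (r ^ n * Z) * (c + C / (2 * α)) * (1 + (8 * (K / Z) + 1) / α) := by
  set t := K / Z / α with ht
  have ht0 : 0 ≤ t := by positivity
  have ht4 : t ≤ 1 / 4 := by rw [ht, div_le_iff₀ hα]; linarith
  have hKt : K / α = t * Z := by rw [ht]; field_simp
  have hKt2 : K / (2 * α) ≤ t * Z := by
    rw [← hKt]; gcongr; linarith
  have hI₁ : Z * (1 - t) ≤ a ^ n * I₁ := by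
    have := (abs_le.1 h₁).1; rw [hKt] at this; linarith
  have hI₂ : (r * a) ^ n * I₂ ≤ Z * (1 + t) := by
    have := (abs_le.1 h₂).2; linarith
  have hZt : 0 < Z * (1 - t) := mul_pos hZ (by linarith)
  have hnum : (r * a) ^ n * (c * I₂ + J) ≤ Z * ((c + C / (2 * α)) * (1 + t)) := by
    have h3 : (r * a) ^ n * J ≤ C * Z / (2 * α) := by
      rw [le_div_iff₀ (by positivity)]; linarith
    have h4 := mul_le_mul_of_nonneg_left hI₂ hc
    have h5 : 0 ≤ Z * (C / (2 * α)) * t := by positivity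
    have h6 : C * Z / (2 * α) = Z * (C / (2 * α)) := by ring
    rw [h6] at h3
    linarith
  have hI₁pos : 0 < I₁ := by
    have : 0 < a ^ n * I₁ := lt_of_lt_of_le hZt hI₁
    exact pos_of_mul_pos_right this (by positivity)
  have hden : (Z * (1 - t)) ^ 2 ≤ (a ^ n * I₁) ^ 2 := by gcongr
  have hpoly : 1 + t ≤ (1 + 8 * t) * (1 - t) ^ 2 := by nlinarith [mul_nonneg ht0 ht0, pow_nonneg ht0 3]
  have hle : 1 + 8 * t ≤ 1 + (8 * (K / Z) + 1) / α := by
    have e : (8 * (K / Z) + 1) / α = 8 * t + 1 / α := by rw [ht]; ring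
    have : 0 < 1 / α := by positivity
    linarith
  set D := c + C / (2 * α) with hD
  have hD0 : 0 ≤ D := by positivity
  refine le_trans ?_ (mul_le_mul_of_nonneg_left hle (by positivity))
  rw [div_le_iff₀ (by positivity)]
  have hra : 0 < (r * a) ^ n := by positivity
  refine le_of_mul_le_mul_left (hnum.trans ?_) hra
  calc Z * (D * (1 + t)) ≤ Z * (D * ((1 + 8 * t) * (1 - t) ^ 2)) := by gcongr
    _ = (Z * (1 - t)) ^ 2 * (D * (1 + 8 * t) / Z) := by field_simp
    _ ≤ (a ^ n * I₁) ^ 2 * (D * (1 + 8 * t) / Z) := by gcongr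
    _ = _ := by rw [mul_pow, mul_pow]; field_simp

lemma two_rpow_mul_mconst (hf : IsObjective f xs) {α : ℝ} (hα : 0 < α) :
    (2 : ℝ) ^ (-(d : ℝ) / 2) * mconst f xs α = Real.sqrt α ^ d /
      (Real.sqrt 2 ^ d * ∫ y : E d, Real.exp (-halfQuad (hess f xs) y)) := by
  have hdet := Real.sqrt_pos.2 hf.posDef.det_pos
  rw [integral_exp_neg_halfQuad hf.posDef, mconst, neg_div, Real.rpow_neg (by norm_num),
    Real.rpow_div_two_eq_sqrt _ (by norm_num), Real.rpow_div_two_eq_sqrt _ (by positivity),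
    Real.rpow_div_two_eq_sqrt _ (by positivity), Real.rpow_natCast, Real.rpow_natCast,
    Real.rpow_natCast, Real.sqrt_div hα.le, div_pow]
  have : 0 < Real.sqrt (2 * Real.pi) := by positivity
  field_simp

end

/-! ### Importance weights -/

section

variable {d q : ℕ} {f : E d → ℝ} {xs : E d} {q₀ : E d → ℝ} {φ : E d → E q}

lemma IsObjective.shift_nonneg (hf : IsObjective f xs) (x : E d) : 0 ≤ f x - f xs := by
  by_cases h : x = xs
  · simp [h]
  · linarith [hf.unique_min x h]

lemma IsObjective.integrable_exp_neg_mul (hf : IsObjective f xs) {β : ℝ} (hβ : 1 ≤ β) :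
    Integrable fun x => Real.exp (-(β * (f x - f xs))) := by
  have hfc := hf.contDiff.continuous
  refine (hf.integrable.const_mul (Real.exp (f xs))).mono'
    (by fun_prop : Continuous _).aestronglyMeasurable (ae_of_all _ fun x => ?_)
  rw [Real.norm_of_nonneg (Real.exp_nonneg _), ← Real.exp_add]
  gcongr
  nlinarith [hf.shift_nonneg x]

lemma Zc_eq (f : E d → ℝ) (xs : E d) (α : ℝ) :
    Zc f α = Real.exp (-(α * f xs)) * ∫ u, Real.exp (-(α * (f (xs + u) - f xs))) := by
  rw [integral_add_left_eq_self (fun x => Real.exp (-(α * (f x - f xs)))) xs, Zc,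
    ← integral_const_mul]
  congr 1 with x
  rw [← Real.exp_add]
  ring_nf

lemma IsProposal.integrable_exp_neg_mul (hf : IsObjective f xs) (hp : IsProposal f xs q₀ φ)
    {β : ℝ} (hβ : 2 ≤ β) :
    Integrable fun x => Real.exp (-(β * (f x - f xs))) * (‖φ x‖ ^ 2 / q₀ x) := by
  obtain ⟨c₀, hc₀, hdom⟩ := hp.dominates
  have hfc := hf.contDiff.continuous
  refine (hp.integrable_sq.const_mul c₀).mono'
    ((by fun_prop : Continuous fun x => Real.exp (-(β * (f x - f xs)))).mul
      hp.contDiff_sq.continuous).aestronglyMeasurable (ae_of_all _ fun x => ?_)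
  have hq := hp.pos x
  have hg := hf.shift_nonneg x
  rw [Real.norm_of_nonneg (by positivity)]
  have h1 : Real.exp (-(β * (f x - f xs)))
      ≤ Real.exp (-(f x - f xs)) * Real.exp (-(f x - f xs)) := by
    rw [← Real.exp_add]; gcongr; nlinarith
  calc _ ≤ Real.exp (-(f x - f xs)) * (c₀ * q₀ x) * (‖φ x‖ ^ 2 / q₀ x) := by
        gcongr
        exact h1.trans (by gcongr; exact hdom x)
    _ = _ := by field_simp

lemma density_mul_norm_weight_smul_sq (hp : IsProposal f xs q₀ φ) (α : ℝ) (x : E d) :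
    q₀ x * ‖weight f q₀ α x • φ x‖ ^ 2 = (∫ u, Real.exp (-(α * (f (xs + u) - f xs))))⁻¹ ^ 2 *
      (Real.exp (-(2 * α * (f x - f xs))) * (‖φ x‖ ^ 2 / q₀ x)) := by
  have hq := (hp.pos x).ne'
  rw [norm_smul, mul_pow, Real.norm_eq_abs, sq_abs, weight, Zc_eq f xs]
  have e : Real.exp (-α * f x) ^ 2
      = Real.exp (-(α * f xs)) ^ 2 * Real.exp (-(2 * α * (f x - f xs))) := by
    rw [← Real.exp_nat_mul, ← Real.exp_nat_mul, ← Real.exp_add]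
    congr 1; push_cast; ring
  rw [div_pow, e, mul_pow, mul_pow, div_eq_mul_inv, mul_inv, mul_inv]
  have he : (Real.exp (-(α * f xs)) ^ 2) ≠ 0 := by positivity
  generalize (∫ u, Real.exp (-(α * (f (xs + u) - f xs)))) = I at *
  rw [inv_pow]
  field_simp

lemma integral_comp_of_map_withDensity (hp : IsProposal f xs q₀ φ) {Ω : Type*} [MeasurableSpace Ω]
    {P : Measure Ω} {X : Ω → E d} (hX : AEMeasurable X P)
    (hlaw : P.map X = volume.withDensity (fun x => ENNReal.ofReal (q₀ x)))
    {F : E d → ℝ} (hF : Measurable F) (hint : Integrable fun x => q₀ x * F x) :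
    Integrable (fun ω => F (X ω)) P ∧ ∫ ω, F (X ω) ∂P = ∫ x, q₀ x * F x := by
  have hqm : Measurable fun x => ENNReal.ofReal (q₀ x) :=
    hp.contDiff.continuous.measurable.ennreal_ofReal
  have hlt : ∀ᵐ x, ENNReal.ofReal (q₀ x) < ⊤ := ae_of_all _ fun x => ENNReal.ofReal_lt_top
  have e : ∀ x, (ENNReal.ofReal (q₀ x)).toReal • F x = q₀ x * F x := fun x => by
    rw [ENNReal.toReal_ofReal (hp.pos x).le, smul_eq_mul]
  constructor
  · have h1 : Integrable F (P.map X) := by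
      rw [hlaw, integrable_withDensity_iff_integrable_smul' hqm hlt]
      simpa only [e] using hint
    exact h1.comp_aemeasurable hX
  · rw [← integral_map hX hF.aestronglyMeasurable, hlaw,
      integral_withDensity_eq_integral_toReal_smul hqm hlt]
    simp only [e]

end

end Laplace

end

open Filter Topology in
/-- Second moment of the weighted test function. The constant `C₁` depends on `f` only, the
threshold `αt` on `f`, `q₀` and `φ` only. -/
theorem stmt3 {d : ℕ} (hd : 1 ≤ d) (f : Laplace.E d → ℝ) (xs : Laplace.E d)
    (hf : Laplace.IsObjective f xs) :
    ∃ C₁ : ℝ, 0 < C₁ ∧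
      ∀ {q : ℕ} (q₀ : Laplace.E d → ℝ) (φ : Laplace.E d → Laplace.E q),
        Laplace.IsProposal f xs q₀ φ →
        ∃ αt : ℝ, 1 < αt ∧
          ∀ {Ω : Type*} [MeasurableSpace Ω] (P : Measure Ω) [IsProbabilityMeasure P]
            (X : Ω → Laplace.E d), AEMeasurable X P →
            P.map X = volume.withDensity (fun x => ENNReal.ofReal (q₀ x)) →
            ∀ α : ℝ, αt ≤ α →
              Integrable (fun ω => ‖Laplace.weight f q₀ α (X ω) • φ (X ω)‖ ^ 2) P ∧
              ∫ ω, ‖Laplace.weight f q₀ α (X ω) • φ (X ω)‖ ^ 2 ∂P ≤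
                (2 : ℝ) ^ (-(d : ℝ) / 2) * Laplace.mconst f xs α *
                  (‖φ xs‖ ^ 2 / q₀ xs +
                    Laplace.lapC f xs (fun x => ‖φ x‖ ^ 2 / q₀ x) / (2 * α)) *
                  (1 + C₁ / α) := by
  obtain ⟨κ, δ, η, M, h⟩ := hf.exists_isLaplaceModel
  obtain ⟨K, hK, hA⟩ := h.normalizer_asymptotics
  rw [finrank_euclideanSpace, Fintype.card_fin] at hA
  set Z := ∫ y, Real.exp (-Laplace.halfQuad (Laplace.hess f xs) y) with hZdef
  have hZ : 0 < Z := by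
    have := hf.posDef.det_pos
    rw [hZdef, Laplace.integral_exp_neg_halfQuad hf.posDef]
    positivity
  refine ⟨8 * (K / Z) + 1, by positivity, fun {q} q₀ φ hp => ?_⟩
  set ψ : Laplace.E d → ℝ := fun x => ‖φ x‖ ^ 2 / q₀ x with hψdef
  have hψint : ∀ {β : ℝ}, 2 ≤ β →
      Integrable fun u => Real.exp (-(β * (f (xs + u) - f xs))) * ψ (xs + u) := fun {β} hβ =>
    (hp.integrable_exp_neg_mul hf hβ).comp_add_left xs
  have hcint : ∀ {β : ℝ}, 2 ≤ β →
      Integrable fun u => Real.exp (-(β * (f (xs + u) - f xs))) := fun {β} hβ =>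
    (hf.integrable_exp_neg_mul (by linarith : 1 ≤ β)).comp_add_left xs
  have hdiff : ∀ {β : ℝ}, 2 ≤ β →
      Integrable fun u => Real.exp (-(β * (f (xs + u) - f xs))) * (ψ (xs + u) - ψ xs) :=
    fun {β} hβ => ((hψint hβ).sub ((hcint hβ).mul_const (ψ xs))).congr
      (ae_of_all _ fun u => by simp only [Pi.sub_apply]; ring)
  have hC : 0 < Laplace.lapC f xs ψ := hp.lapC_sq
  have hB := hf.tendsto_laplace hp.contDiff_sq (hdiff le_rfl)
  have hBle := hB.eventually (gt_mem_nhds (show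
      1 / 2 * Laplace.signedLapC f xs ψ * Z < Laplace.lapC f xs ψ * Z by
    gcongr
    have : Laplace.signedLapC f xs ψ ≤ Laplace.lapC f xs ψ := le_abs_self _
    linarith))
  have hsq1 : Tendsto (fun α : ℝ => Real.sqrt α) atTop atTop := Real.tendsto_sqrt_atTop
  have hsq2 : Tendsto (fun α : ℝ => Real.sqrt 2 * Real.sqrt α) atTop atTop :=
    hsq1.const_mul_atTop (by positivity)
  obtain ⟨N, hN⟩ := ((hsq1.eventually hA).and ((hsq2.eventually hA).and
    ((hsq2.eventually hBle).and (eventually_ge_atTop (4 * (K / Z)))))).exists_forall_of_atTop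
  refine ⟨max N 2, lt_max_of_lt_right one_lt_two, fun {Ω} _ P _ X hX hlaw α hα => ?_⟩
  have hα2 : 2 ≤ α := (le_max_right _ _).trans hα
  have hα0 : 0 < α := by linarith
  obtain ⟨hA1, hA2, hB1, hKα⟩ := hN α ((le_max_left _ _).trans hα)
  have hs1 : Real.sqrt α ^ 2 = α := Real.sq_sqrt hα0.le
  have hs2 : (Real.sqrt 2 * Real.sqrt α) ^ 2 = 2 * α := by
    rw [mul_pow, hs1, Real.sq_sqrt (by norm_num)]
  simp only [pow_add, hs1, hs2] at hA1 hA2 hB1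
  set I₁ := ∫ u, Real.exp (-(α * (f (xs + u) - f xs)))
  have hfm := hf.contDiff.continuous.measurable
  have hqm := hp.contDiff.continuous.measurable
  have hφm := hp.measurable
  have hdens := Laplace.density_mul_norm_weight_smul_sq hp α
  have hFm : Measurable fun x => ‖Laplace.weight f q₀ α x • φ x‖ ^ 2 := by
    unfold Laplace.weight
    fun_prop
  have hFint : Integrable fun x => q₀ x * ‖Laplace.weight f q₀ α x • φ x‖ ^ 2 := by
    simp only [hdens]
    exact (hp.integrable_exp_neg_mul hf (by linarith : 2 ≤ 2 * α)).const_mul _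
  obtain ⟨hint, heq⟩ := Laplace.integral_comp_of_map_withDensity hp hX hlaw hFm hFint
  refine ⟨hint, ?_⟩
  rw [heq]
  simp only [hdens]
  rw [integral_const_mul, ← integral_add_left_eq_self
    (fun x => Real.exp (-(2 * α * (f x - f xs))) * (‖φ x‖ ^ 2 / q₀ x)) xs]
  have hsplit : ∫ u, Real.exp (-(2 * α * (f (xs + u) - f xs))) * ψ (xs + u)
      = ψ xs * (∫ u, Real.exp (-(2 * α * (f (xs + u) - f xs))))
        + ∫ u, Real.exp (-(2 * α * (f (xs + u) - f xs))) * (ψ (xs + u) - ψ xs) := by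
    rw [← integral_const_mul, ← integral_add ((hcint (by linarith)).const_mul _)
      (hdiff (by linarith))]
    congr 1 with u
    ring
  have hfin := Laplace.second_moment_ratio_le (c := ψ xs) (C := Laplace.lapC f xs ψ)
    (by positivity : 0 < Real.sqrt α) (by positivity : 0 < Real.sqrt 2) hα0 hZ hK
    (div_nonneg (by positivity) (hp.pos xs).le) hC.le hA1 hA2 hB1.le hKα
  rw [← hsplit, ← Laplace.two_rpow_mul_mconst hf hα0] at hfin
  refine le_trans (le_of_eq ?_) hfin
  rw [inv_pow, div_eq_inv_mul]
end
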